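/- Let G be a graph in which every cycle has length at least 7 (girth at least 7) and with φ_r(G) ≥ 3. Then φ(G) = φ_r(G). -/

import Mathlib

noncomputable section

open Function

/-- A proper coloring of `G` with colors in `Fin k`. -/
def IsProperColoring {V : Type} (G : SimpleGraph V) {k : ℕ} (c : V → Fin k) : Prop :=
  ∀ u v : V, G.Adj u v → c u ≠ c v

/-- A b-`k`-coloring: a surjective proper coloring in which every color class
contains a b-vertex. -/
def IsBColoring {V : Type} (G : SimpleGraph V) {k : ℕ} (c : V → Fin k) : Prop :=
  Function.Surjective c ∧ IsProperColoring G c ∧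
    ∀ i : Fin k, ∃ v : V, c v = i ∧ ∀ j : Fin k, j ≠ i → ∃ u : V, G.Adj v u ∧ c u = j

def HasBColoring {V : Type} (G : SimpleGraph V) (k : ℕ) : Prop :=
  ∃ c : V → Fin k, IsBColoring G c

/-- The b-chromatic number `φ(G)`. -/
def bChromatic {V : Type} [Fintype V] (G : SimpleGraph V) : ℕ :=
  sSup {k | HasBColoring G k}

/-- The b-relaxed number `φ_r(G)`: the maximum of `φ(H)` over induced subgraphs `H`. -/
def bRelaxed {V : Type} [Fintype V] (G : SimpleGraph V) : ℕ :=
  sSup {k | ∃ s : Finset V, bChromatic (G.induce (↑s : Set V)) = k}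

/-- A partial Grundy `k`-coloring: a surjective proper coloring in which every
color class contains a Grundy vertex. -/
def IsPartialGrundyColoring {V : Type} (G : SimpleGraph V) {k : ℕ} (c : V → Fin k) : Prop :=
  Function.Surjective c ∧ IsProperColoring G c ∧
    ∀ i : Fin k, ∃ v : V, c v = i ∧ ∀ j : Fin k, j < i → ∃ u : V, G.Adj v u ∧ c u = j

/-- The partial Grundy number `∂Γ(G)`. -/
def partialGrundy {V : Type} [Fintype V] (G : SimpleGraph V) : ℕ :=
  sSup {k | ∃ c : V → Fin k, IsPartialGrundyColoring G c}

/-- A pG-`t`-atom structure on a graph `A`. -/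
def IsPGAtom {V : Type} (A : SimpleGraph V) (t : ℕ) : Prop :=
  ∃ (D : Fin t → Finset V) (c : Fin t → V),
    (∀ v : V, ∃! i : Fin t, v ∈ D i) ∧
    (∀ i : Fin t, c i ∈ D i) ∧
    (∀ i : Fin t, ∀ u ∈ D i, ∀ v ∈ D i, ¬ A.Adj u v) ∧
    (∀ i : Fin t, (D i).card ≤ t - (i : ℕ)) ∧
    (∀ i j : Fin t, j < i → ∃ v ∈ D j, A.Adj (c i) v)

/-- A minimal pG-`t`-atom: no proper induced subgraph is a pG-`t`-atom. -/
def IsMinPGAtom {V : Type} [Fintype V] (A : SimpleGraph V) (t : ℕ) : Prop :=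
  IsPGAtom A t ∧
    ∀ s : Finset V, s ≠ Finset.univ → ¬ IsPGAtom (A.induce (↑s : Set V)) t

/-- A b-`t`-atom structure on a graph `A`. -/
def IsBAtom {V : Type} (A : SimpleGraph V) (t : ℕ) : Prop :=
  ∃ (D : Fin t → Finset V) (c : Fin t → V),
    (∀ v : V, ∃! i : Fin t, v ∈ D i) ∧
    (∀ i : Fin t, c i ∈ D i) ∧
    (∀ i : Fin t, ∀ u ∈ D i, ∀ v ∈ D i, ¬ A.Adj u v) ∧
    (∀ i : Fin t, (D i).card ≤ t) ∧
    (∀ i j : Fin t, i ≠ j → ∃ v ∈ D j, A.Adj (c i) v)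

/-- A minimal b-`t`-atom: no proper induced subgraph is a b-`t`-atom. -/
def IsMinBAtom {V : Type} [Fintype V] (A : SimpleGraph V) (t : ℕ) : Prop :=
  IsBAtom A t ∧
    ∀ s : Finset V, s ≠ Finset.univ → ¬ IsBAtom (A.induce (↑s : Set V)) t

/-- `V(A) ∪ N(A)` for the induced subgraph of `G` on `s`. -/
def closedNbhdSet {V : Type} (G : SimpleGraph V) (s : Set V) : Set V :=
  s ∪ {v : V | v ∉ s ∧ ∃ u ∈ s, G.Adj u v}

/-- The induced subgraph of `G` on `s` is feasible (as a b-`t`-atom) in `G`: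
some b-`t`-coloring of it extends to a proper coloring of the induced subgraph
on `V(A) ∪ N(A)` using only the `t` colors. -/
def IsFeasibleIn {V : Type} (G : SimpleGraph V) (s : Finset V) (t : ℕ) : Prop :=
  ∃ c : V → Fin t,
    IsBColoring (G.induce (↑s : Set V)) (fun v => c v.1) ∧
    ∀ u v : V, u ∈ closedNbhdSet G (↑s : Set V) → v ∈ closedNbhdSet G (↑s : Set V) →
      G.Adj u v → c u ≠ c v

/-- A b-`t`-trap vertex: an induced b-`t`-atom avoiding `v`, not feasible in `G`
but feasible in `G - v`. -/
def IsVertexBTrap {V : Type} [Fintype V] [DecidableEq V] (G : SimpleGraph V) (v : V)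
    (t : ℕ) : Prop :=
  ∃ s : Finset V, v ∉ s ∧ IsBAtom (G.induce (↑s : Set V)) t ∧ ¬ IsFeasibleIn G s t ∧
    IsFeasibleIn (G.induce {u : V | u ≠ v}) (s.subtype (fun u => u ≠ v)) t

/-- A b-`t`-trap edge: an induced b-`t`-atom, not feasible in `G`
but feasible in `G - e`. -/
def IsEdgeBTrap {V : Type} (G : SimpleGraph V) (e : Sym2 V) (t : ℕ) : Prop :=
  ∃ s : Finset V, IsBAtom (G.induce (↑s : Set V)) t ∧ ¬ IsFeasibleIn G s t ∧
    IsFeasibleIn (G.deleteEdges {e}) s t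

/-- The chromatic number as a natural number (least `k` admitting a surjective
proper `k`-coloring). -/
def chromaticNum {V : Type} [Fintype V] (G : SimpleGraph V) : ℕ :=
  sInf {k | ∃ c : V → Fin k, Function.Surjective c ∧ IsProperColoring G c}

/-- `G` is b-χ-`k`-bounded: `φ(G') - χ(G') ≤ k` for every induced subgraph `G'`. -/
def IsBChiBounded {V : Type} [Fintype V] (G : SimpleGraph V) (k : ℕ) : Prop :=
  ∀ s : Finset V,
    bChromatic (G.induce (↑s : Set V)) - chromaticNum (G.induce (↑s : Set V)) ≤ k

/-- A χ-`k`-unbounded b-atom: a b-`t`-atom (for some positive `t`) with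
`φ(G) - χ(G) > k`. -/
def IsChiUnboundedBAtom {V : Type} [Fintype V] (A : SimpleGraph V) (k : ℕ) : Prop :=
  k < bChromatic A - chromaticNum A ∧ ∃ t : ℕ, 1 ≤ t ∧ IsBAtom A t

/-- A minimal χ-`k`-unbounded b-atom. -/
def IsMinChiUnboundedBAtom {V : Type} [Fintype V] (A : SimpleGraph V) (k : ℕ) : Prop :=
  IsChiUnboundedBAtom A k ∧
    ∀ s : Finset V, s ≠ Finset.univ → ¬ IsChiUnboundedBAtom (A.induce (↑s : Set V)) k

end


/-- The local consequences of having no cycle of length at most six. Closed walks of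
length three or five are excluded outright; closed walks of length four or six are
excluded as soon as they do not backtrack. -/
structure GirthSeven {V : Type} (G : SimpleGraph V) : Prop where
  no3 : ∀ {a b c : V}, G.Adj a b → G.Adj b c → G.Adj c a → False
  no4 : ∀ {a b c d : V}, G.Adj a b → G.Adj b c → G.Adj c d → G.Adj d a →
    a ≠ c → b ≠ d → False
  no5 : ∀ {a b c d e : V}, G.Adj a b → G.Adj b c → G.Adj c d → G.Adj d e → G.Adj e a → False
  no6 : ∀ {a b c d e f : V}, G.Adj a b → G.Adj b c → G.Adj c d → G.Adj d e → G.Adj e f →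
    G.Adj f a → a ≠ c → b ≠ d → c ≠ e → d ≠ f → e ≠ a → f ≠ b → False

theorem girthSeven_of_cycles {V : Type} {G : SimpleGraph V}
    (hg : ∀ (v : V) (w : G.Walk v v), w.IsCycle → 7 ≤ w.length) : GirthSeven G := by
  have h3 : ∀ {a b c : V}, G.Adj a b → G.Adj b c → G.Adj c a → False := by
    intro a b c h1 h2 h3
    have := hg a (.cons h1 (.cons h2 (.cons h3 .nil))) (by
      simp [SimpleGraph.Walk.cons_isCycle_iff]
      grind [h1.ne, h2.ne, h3.ne])
    simp at this
  have h5 : ∀ {a b c d e : V}, G.Adj a b → G.Adj b c → G.Adj c d → G.Adj d e → G.Adj e a →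
      False := by
    intro a b c d e h1 h2 h3' h4 h5
    have n1 : a ≠ c := by rintro rfl; exact h3 h3' h4 h5
    have n2 : b ≠ d := by rintro rfl; exact h3 h4 h5 h1
    have n3 : c ≠ e := by rintro rfl; exact h3 h5 h1 h2
    have n4 : d ≠ a := by rintro rfl; exact h3 h1 h2 h3'
    have n5 : e ≠ b := by rintro rfl; exact h3 h2 h3' h4
    have := hg a (.cons h1 (.cons h2 (.cons h3' (.cons h4 (.cons h5 .nil))))) (by
      simp [SimpleGraph.Walk.cons_isCycle_iff]
      grind [h1.ne, h2.ne, h3'.ne, h4.ne, h5.ne])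
    simp at this
  refine ⟨h3, ?_, h5, ?_⟩
  · intro a b c d h1 h2 h3' h4 n1 n2
    have := hg a (.cons h1 (.cons h2 (.cons h3' (.cons h4 .nil)))) (by
      simp [SimpleGraph.Walk.cons_isCycle_iff]
      grind [h1.ne, h2.ne, h3'.ne, h4.ne])
    simp at this
  · intro a b c d e f h1 h2 h3' h4 h5' h6 n1 n2 n3 n4 n5 n6
    have m1 : a ≠ d := by rintro rfl; exact h3 h1 h2 h3'
    have m2 : b ≠ e := by rintro rfl; exact h3 h2 h3' h4
    have m3 : c ≠ f := by rintro rfl; exact h3 h3' h4 h5'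
    have := hg a (.cons h1 (.cons h2 (.cons h3' (.cons h4 (.cons h5' (.cons h6 .nil)))))) (by
      simp [SimpleGraph.Walk.cons_isCycle_iff]
      grind [h1.ne, h2.ne, h3'.ne, h4.ne, h5'.ne, h6.ne])
    simp at this

/-- A set of pairs with fewer elements than `F` cannot obstruct matching `A` into `F`. -/
theorem exists_matching_avoiding {α β : Type} [DecidableEq α] [DecidableEq β]
    (F : Finset α) (A : Finset β) (X : Finset (α × β)) (hA : A.card ≤ F.card)
    (hX : X.card < F.card) :
    ∃ g : A → α, Function.Injective g ∧ ∀ a : A, g a ∈ F ∧ (g a, (a : β)) ∉ X := by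
  obtain ⟨g, hg, hg'⟩ := (Finset.all_card_le_biUnion_card_iff_exists_injective
    (fun a : A => F.filter (fun x => (x, (a : β)) ∉ X))).1 (by
      intro s
      by_contra! hlt
      rcases s.eq_empty_or_nonempty with rfl | ⟨a₀, ha₀⟩
      · simp at hlt
      set T := s.biUnion (fun a : A => F.filter (fun x => (x, (a : β)) ∉ X)) with hT
      have hTF : T ⊆ F := by
        intro x hx
        simp only [hT, Finset.mem_biUnion, Finset.mem_filter] at hx
        grind
      have hsub : (F \ T) ×ˢ (s.map (Function.Embedding.subtype _)) ⊆ X := by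
        rintro ⟨x, b⟩ hxb
        simp only [Finset.mem_product, Finset.mem_sdiff, Finset.mem_map,
          Function.Embedding.subtype_apply] at hxb
        obtain ⟨⟨hxF, hxT⟩, a, ha, rfl⟩ := hxb
        by_contra hne
        exact hxT (Finset.mem_biUnion.2 ⟨a, ha, Finset.mem_filter.2 ⟨hxF, hne⟩⟩)
      have h1 := Finset.card_le_card hsub
      rw [Finset.card_product, Finset.card_map, Finset.card_sdiff_of_subset hTF] at h1
      have h2 : s.card ≤ A.card := by simpa using Finset.card_le_univ s
      have h3 : 1 ≤ s.card := Finset.card_pos.2 ⟨a₀, ha₀⟩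
      have h4 := Finset.card_le_card hTF
      obtain ⟨p, hp⟩ : ∃ p, s.card = p + 1 := ⟨s.card - 1, by omega⟩
      obtain ⟨q, hq⟩ : ∃ q, F.card = T.card + q := ⟨F.card - T.card, by omega⟩
      have h5 : p + 1 ≤ F.card := by omega
      have h6 : F.card ≤ q + p := by omega
      have h7 : 1 ≤ q := by omega
      rw [hp, hq, Nat.add_sub_cancel_left] at h1
      nlinarith)
  exact ⟨g, hg, fun a => by simpa using hg' a⟩

/-- `v` has a neighbour of every color other than its own. -/
def IsBVertex {V : Type} (G : SimpleGraph V) {k : ℕ} (c : V → Fin k) (v : V) : Prop :=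
  ∀ j : Fin k, j ≠ c v → ∃ u : V, G.Adj v u ∧ c u = j

theorem exists_hasBColoring_of_bVertices {V : Type} {G : SimpleGraph V} {k : ℕ}
    (c : V → Fin k) (hc : IsProperColoring G c) (B : Finset (Fin k))
    (hB : ∀ i ∈ B, ∃ v, c v = i ∧ IsBVertex G c v) :
    ∃ l, B.card ≤ l ∧ HasBColoring G l := by
  induction k with
  | zero =>
    exact ⟨0, by simpa using Finset.card_le_univ B, c, fun i => i.elim0, hc, fun i => i.elim0⟩
  | succ k ih =>
    by_cases hall : ∀ i, ∃ v, c v = i ∧ IsBVertex G c v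
    · refine ⟨k + 1, by simpa using Finset.card_le_univ B, c, fun i => ?_, hc, fun i => ?_⟩
      · obtain ⟨v, hv, -⟩ := hall i
        exact ⟨v, hv⟩
      · obtain ⟨v, rfl, hv⟩ := hall i
        exact ⟨v, rfl, hv⟩
    · push Not at hall
      obtain ⟨i, hi⟩ := hall
      have hmove : ∀ v, ∃ b : Fin k, (c v ≠ i → i.succAbove b = c v) ∧
          (c v = i → ∀ u, G.Adj v u → c u ≠ i.succAbove b) := by
        intro v
        by_cases hv : c v = i
        · have := hi v hv
          unfold IsBVertex at this
          push Not at this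
          obtain ⟨j, hj, hj'⟩ := this
          obtain ⟨b, hb⟩ := Fin.exists_succAbove_eq (hv ▸ hj)
          exact ⟨b, fun h => absurd hv h, fun _ u hu => hb ▸ hj' u hu⟩
        · obtain ⟨b, hb⟩ := Fin.exists_succAbove_eq hv
          exact ⟨b, fun _ => hb, fun h => absurd h hv⟩
      choose d hd1 hd2 using hmove
      obtain ⟨l, hl, hl'⟩ := ih d (by
        intro u v huv heq
        by_cases hu : c u = i
        · have hv : c v ≠ i := fun h => hc u v huv (hu.trans h.symm)
          exact hd2 u hu v huv (by rw [heq, hd1 v hv])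
        · by_cases hv : c v = i
          · exact hd2 v hv u huv.symm (by rw [← heq, hd1 u hu])
          · exact hc u v huv (by rw [← hd1 u hu, ← hd1 v hv, heq]))
        (Finset.univ.filter fun b => i.succAbove b ∈ B) (by
          intro b hb
          obtain ⟨v, hv, hbv⟩ := hB _ (Finset.mem_filter.1 hb).2
          have hvi : c v ≠ i := hv ▸ Fin.succAbove_ne i b
          have hdv : d v = b := Fin.succAbove_right_injective (by rw [hd1 v hvi, hv])
          refine ⟨v, hdv, fun j hj => ?_⟩
          obtain ⟨u, hu, hcu⟩ := hbv (i.succAbove j) (by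
            rw [hv]
            exact fun h => hj (by rw [hdv]; exact Fin.succAbove_right_injective h))
          have hui : c u ≠ i := hcu ▸ Fin.succAbove_ne i j
          exact ⟨u, hu, Fin.succAbove_right_injective (by rw [hd1 u hui, hcu])⟩)
      refine ⟨l, le_trans ?_ hl, hl'⟩
      have hiB : i ∉ B := fun h => by
        obtain ⟨v, hv, hbv⟩ := hB i h
        exact hi v hv hbv
      have : B = (Finset.univ.filter fun b => i.succAbove b ∈ B).map (Fin.succAboveEmb i) := by
        ext a
        simp only [Finset.mem_map, Finset.mem_filter, Finset.mem_univ, true_and]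
        constructor
        · intro ha
          obtain ⟨b, hb⟩ := Fin.exists_succAbove_eq (x := a) (y := i) (fun h => hiB (h ▸ ha))
          exact ⟨b, by rwa [hb], hb⟩
        · rintro ⟨b, hb, rfl⟩
          exact hb
      rw [this, Finset.card_map]
      simp

/-- No edge of `G` has both ends colored alike by the partial coloring `f`. -/
def PProper {V : Type} (G : SimpleGraph V) {m : ℕ} (f : V → Option (Fin m)) : Prop :=
  ∀ u v a, G.Adj u v → f u = some a → f v ≠ some a

/-- The degree of a vertex, for the classical decidability instance. -/
noncomputable def dg {V : Type} [Fintype V] (G : SimpleGraph V) (v : V) : ℕ :=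
  open Classical in (Finset.univ.filter (G.Adj v)).card

open Classical in
theorem exists_extension_of_dg_lt {V : Type} [Fintype V] {G : SimpleGraph V} {m : ℕ}
    (f : V → Option (Fin m)) (hf : PProper G f) (hdeg : ∀ u, f u = none → dg G u < m) :
    ∃ c : V → Fin m, IsProperColoring G c ∧ ∀ u a, f u = some a → c u = a := by
  induction hn : (Finset.univ.filter fun u => f u = none).card generalizing f with
  | zero =>
    have hall : ∀ u, ∃ a, f u = some a := by
      intro u
      rw [Finset.card_eq_zero, Finset.filter_eq_empty_iff] at hn
      exact Option.ne_none_iff_exists'.1 (hn (Finset.mem_univ u))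
    choose c hc using hall
    refine ⟨c, fun u v huv h => hf u v (c u) huv (hc u) (h ▸ hc v), fun u a h => ?_⟩
    simpa [hc u] using h
  | succ n ih =>
    obtain ⟨x, hx⟩ : (Finset.univ.filter fun u => f u = none).Nonempty := by
      rw [← Finset.card_pos]; omega
    have hx0 : f x = none := by simpa using hx
    obtain ⟨a, ha⟩ : ∃ a : Fin m, ∀ u, G.Adj x u → f u ≠ some a := by
      by_contra! h
      choose g hg hg' using h
      have hinj : Function.Injective g := fun a b h => by
        have := hg' a
        rw [h, hg' b] at this
        simpa using this.symm
      have := Finset.card_le_card (s := Finset.univ.image g)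
        (t := Finset.univ.filter (G.Adj x)) (by
          intro y hy
          obtain ⟨a, -, rfl⟩ := Finset.mem_image.1 hy
          simp [hg a])
      rw [Finset.card_image_of_injective _ hinj] at this
      have h2 := hdeg x hx0
      simp only [Finset.card_univ, Fintype.card_fin] at this
      unfold dg at h2
      omega
    obtain ⟨c, hc, hc'⟩ := ih (Function.update f x (some a)) (by
      intro u v b huv hu hv
      by_cases hux : u = x
      · subst hux
        have hvu : v ≠ u := huv.ne'
        simp only [Function.update_self, Option.some.injEq] at hu
        rw [Function.update_of_ne hvu] at hv
        exact ha v huv (hu ▸ hv)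
      · rw [Function.update_of_ne hux] at hu
        by_cases hvx : v = x
        · subst hvx
          simp only [Function.update_self, Option.some.injEq] at hv
          exact ha u huv.symm (hv ▸ hu)
        · rw [Function.update_of_ne hvx] at hv
          exact hf u v b huv hu hv)
      (by
        intro u hu
        by_cases hux : u = x
        · simp [hux] at hu
        · exact hdeg u (by rwa [Function.update_of_ne hux] at hu))
      (by
        have : (Finset.univ.filter fun u => Function.update f x (some a) u = none) =
            (Finset.univ.filter fun u => f u = none).erase x := by
          ext u
          by_cases hux : u = x <;> simp [hux]
        rw [this, Finset.card_erase_of_mem hx, hn]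
        rfl)
    refine ⟨c, hc, fun u b hu => hc' u b ?_⟩
    have : u ≠ x := by rintro rfl; simp [hx0] at hu
    rwa [Function.update_of_ne this]

/-- A vertex outside the family `w` with at least two neighbours in it. -/
def IsLink {V : Type} (G : SimpleGraph V) {m : ℕ} (w : Fin m → V) (x : V) : Prop :=
  (∀ i, w i ≠ x) ∧ ∃ i j, i ≠ j ∧ G.Adj x (w i) ∧ G.Adj x (w j)

/-- Every member of the family `w` is a neighbour of `x`, or a neighbour of one. -/
def Encircles {V : Type} (G : SimpleGraph V) {m : ℕ} (w : Fin m → V) (x : V) : Prop :=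
  ∀ i, G.Adj x (w i) ∨ ∃ s, G.Adj x (w s) ∧ G.Adj (w s) (w i)

/-- A partial coloring giving `w i` the color `i`, coloring apart from that only links, and
giving different colors to the colored neighbours of each `w i`. -/
structure IsLinkColoring {V : Type} (G : SimpleGraph V) {m : ℕ} (w : Fin m → V)
    (f : V → Option (Fin m)) : Prop where
  base : ∀ i, f (w i) = some i
  proper : PProper G f
  rainbow : ∀ {i u u' a}, G.Adj (w i) u → G.Adj (w i) u' → f u = some a → f u' = some a → u = u'
  dom : ∀ {u a}, f u = some a → (∃ i, w i = u) ∨ IsLink G w u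

/-- `u` may conflict with `x` in a link coloring. -/
def Conflict {V : Type} (G : SimpleGraph V) {m : ℕ} (w : Fin m → V) (x u : V) : Prop :=
  u ≠ x ∧ (G.Adj x u ∨ ∃ s, G.Adj x (w s) ∧ G.Adj (w s) u)

/-- `u` is the vertex in conflict with `x` that lies on the short path from `x` to `w i`. -/
def ConflictVia {V : Type} (G : SimpleGraph V) {m : ℕ} (w : Fin m → V) (x : V) (i : Fin m) (u : V) :
    Prop :=
  (u = w i ∧ Conflict G w x u) ∨
    (IsLink G w u ∧ u ≠ x ∧ G.Adj u (w i) ∧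
      (G.Adj x u ∨ ∃ s, s ≠ i ∧ G.Adj x (w s) ∧ G.Adj (w s) u))

section LinkColoring

variable {V : Type} {G : SimpleGraph V} {m : ℕ} {w : Fin m → V}

theorem ConflictVia.conflict {x u : V} {i : Fin m} (h : ConflictVia G w x i u) : Conflict G w x u := by
  rcases h with h | ⟨-, hne, -, h | ⟨s, -, h1, h2⟩⟩
  · exact h.2
  · exact ⟨hne, Or.inl h⟩
  · exact ⟨hne, Or.inr ⟨s, h1, h2⟩⟩

theorem ConflictVia.unique (hG : GirthSeven G) (hw : Function.Injective w) {x u u' : V} {i : Fin m}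
    (hx : ∀ i, w i ≠ x) (h : ConflictVia G w x i u) (h' : ConflictVia G w x i u') : u = u' := by
  have aux : ∀ {u u'}, (u = w i ∧ Conflict G w x u) → (IsLink G w u' ∧ u' ≠ x ∧ G.Adj u' (w i) ∧
      (G.Adj x u' ∨ ∃ s, s ≠ i ∧ G.Adj x (w s) ∧ G.Adj (w s) u')) → False := by
    rintro _ u' ⟨rfl, -, h⟩ ⟨hl, hne, ha, h'⟩
    rcases h with h | ⟨s, h1, h2⟩ <;> rcases h' with h' | ⟨t, ht, h3, h4⟩
    · exact hG.no3 h ha.symm h'.symm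
    · exact hG.no4 h ha.symm h4.symm h3.symm hne.symm (fun e => ht (hw e).symm)
    · exact hG.no4 h1 h2 ha.symm h'.symm (hx i).symm (hl.1 s)
    · exact hG.no5 h1 h2 ha.symm h4.symm h3.symm
  rcases h with h | h <;> rcases h' with h' | h'
  · rw [h.1, h'.1]
  · exact (aux h h').elim
  · exact (aux h' h).elim
  · by_contra hne
    obtain ⟨hl, hux, ha, h⟩ := h
    obtain ⟨hl', hux', ha', h'⟩ := h'
    rcases h with h | ⟨s, hs, h1, h2⟩ <;> rcases h' with h' | ⟨t, ht, h3, h4⟩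
    · exact hG.no4 h ha ha'.symm h'.symm (hx i).symm hne
    · exact hG.no5 h ha ha'.symm h4.symm h3.symm
    · exact hG.no5 h' ha' ha.symm h2.symm h1.symm
    · by_cases hst : s = t
      · subst hst
        exact hG.no4 h2 ha ha'.symm h4.symm (fun e => hs (hw e)) hne
      · exact hG.no6 h1 h2 ha ha'.symm h4.symm h3.symm hux.symm (fun e => hs (hw e)) hne
          (fun e => ht (hw e).symm) hux' (fun e => hst (hw e).symm)

theorem Conflict.exists_rep {x u : V} (h : Conflict G w x u)
    (hu : (∃ i, w i = u) ∨ IsLink G w u) : ∃ i, ConflictVia G w x i u := by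
  rcases hu with ⟨i, rfl⟩ | hl
  · exact ⟨i, Or.inl ⟨rfl, h⟩⟩
  · obtain ⟨hne, h⟩ := h
    obtain ⟨i, j, hij, hi, hj⟩ := hl.2
    rcases h with h | ⟨s, h1, h2⟩
    · exact ⟨i, Or.inr ⟨hl, hne, hi, Or.inl h⟩⟩
    · by_cases hs : s = i
      · exact ⟨j, Or.inr ⟨hl, hne, hj, Or.inr ⟨s, hs ▸ hij, h1, h2⟩⟩⟩
      · exact ⟨i, Or.inr ⟨hl, hne, hi, Or.inr ⟨s, hs, h1, h2⟩⟩⟩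

theorem IsLinkColoring.exists_color {f : V → Option (Fin m)} (hf : IsLinkColoring G w f)
    (hG : GirthSeven G) (hw : Function.Injective w) {x : V} (hx : ∀ i, w i ≠ x)
    (hi : ∃ i, ∀ u a, ConflictVia G w x i u → f u = some a →
      ∃ u', u' ≠ u ∧ Conflict G w x u' ∧ f u' = some a) :
    ∃ a, ∀ u, Conflict G w x u → f u ≠ some a := by
  by_contra! h
  obtain ⟨i₀, hi₀⟩ := hi
  have : ∀ a, ∃ u, ∃ i, i ≠ i₀ ∧ ConflictVia G w x i u ∧ f u = some a := by
    have key : ∀ a, ∃ u, Conflict G w x u ∧ f u = some a ∧ ¬ ConflictVia G w x i₀ u := by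
      intro a
      obtain ⟨u, hu, hua⟩ := h a
      by_cases hr : ConflictVia G w x i₀ u
      · obtain ⟨u', hne, hu', hua'⟩ := hi₀ u a hr hua
        exact ⟨u', hu', hua', fun hr' => hne (hr'.unique hG hw hx hr)⟩
      · exact ⟨u, hu, hua, hr⟩
    intro a
    obtain ⟨u, hu, hua, hr⟩ := key a
    obtain ⟨i, hi⟩ := hu.exists_rep (hf.dom hua)
    exact ⟨u, i, fun e => hr (e ▸ hi), hi, hua⟩
  choose u i hne hrep hu using this
  have hinj : Function.Injective i := fun a b hab => by
    have h1 := hrep b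
    rw [← hab] at h1
    have h2 := hu a
    rw [(hrep a).unique hG hw hx h1, hu b] at h2
    simpa using h2.symm
  obtain ⟨a, ha⟩ := Finite.surjective_of_injective hinj i₀
  exact hne a ha

open Classical in
theorem IsLinkColoring.update {f : V → Option (Fin m)} (hf : IsLinkColoring G w f) {x : V}
    (hx : IsLink G w x) {a : Fin m} (ha : ∀ u, Conflict G w x u → f u ≠ some a) :
    IsLinkColoring G w (Function.update f x (some a)) := by
  refine ⟨fun i => ?_, fun u v b huv hu hv => ?_, fun {i u u' b} hu hu' hb hb' => ?_,
    fun {u b} hb => ?_⟩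
  · rw [Function.update_of_ne (hx.1 i), hf.base]
  · by_cases hux : u = x
    · subst hux
      rw [Function.update_self, Option.some.injEq] at hu
      rw [Function.update_of_ne huv.ne'] at hv
      exact ha v ⟨huv.ne', Or.inl huv⟩ (hu ▸ hv)
    · rw [Function.update_of_ne hux] at hu
      by_cases hvx : v = x
      · subst hvx
        rw [Function.update_self, Option.some.injEq] at hv
        exact ha u ⟨hux, Or.inl huv.symm⟩ (hv ▸ hu)
      · rw [Function.update_of_ne hvx] at hv
        exact hf.proper u v b huv hu hv
  · by_cases hux : u = x
    · by_cases hvx : u' = x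
      · rw [hux, hvx]
      · subst hux
        rw [Function.update_self, Option.some.injEq] at hb
        rw [Function.update_of_ne hvx] at hb'
        exact (ha u' ⟨hvx, Or.inr ⟨i, hu.symm, hu'⟩⟩ (hb ▸ hb')).elim
    · rw [Function.update_of_ne hux] at hb
      by_cases hvx : u' = x
      · subst hvx
        rw [Function.update_self, Option.some.injEq] at hb'
        exact (ha u ⟨hux, Or.inr ⟨i, hu'.symm, hu⟩⟩ (hb' ▸ hb)).elim
      · rw [Function.update_of_ne hvx] at hb'
        exact hf.rainbow hu hu' hb hb'
  · by_cases hux : u = x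
    · exact Or.inr (hux ▸ hx)
    · rw [Function.update_of_ne hux] at hb
      exact hf.dom hb

open Classical in
/-- The coloring of the family `w` alone. -/
theorem exists_isLinkColoring_base (hw : Function.Injective w) :
    ∃ f, IsLinkColoring G w f ∧ ∀ u, (∀ i, w i ≠ u) → f u = none := by
  refine ⟨fun u => if h : ∃ i, w i = u then some h.choose else none, ?_, ?_⟩
  · have hval : ∀ i, (if h : ∃ j, w j = w i then some h.choose else none) = some i := by
      intro i
      have h : ∃ j, w j = w i := ⟨i, rfl⟩
      rw [dif_pos h, hw h.choose_spec]
    have hdom : ∀ u a, (if h : ∃ j, w j = u then some h.choose else none) = some a →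
        w a = u := by
      intro u a h
      split_ifs at h with h'
      rw [← Option.some.inj h]
      exact h'.choose_spec
    refine ⟨hval, fun u v a huv hu hv => ?_, fun {i u u' a} _ _ hu hu' => ?_,
      fun {u a} hu => Or.inl ⟨a, hdom u a hu⟩⟩
    · exact huv.ne ((hdom u a hu).symm.trans (hdom v a hv))
    · exact (hdom u a hu).symm.trans (hdom u' a hu')
  · intro u hu
    exact dif_neg (by push Not; exact hu)

open Classical in
/-- Links can be colored one after the other in order of decreasing rank, as long as each of
them leaves some index unused for good or has an uncolored link of smaller rank in conflict
with it. -/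
theorem IsLinkColoring.exists_extension [Fintype V] {f : V → Option (Fin m)}
    (hf : IsLinkColoring G w f) (hG : GirthSeven G) (hw : Function.Injective w) (r : V → ℕ)
    (hr : ∀ x, IsLink G w x → f x = none →
      (∃ i, ∀ u, ConflictVia G w x i u →
        ∃ a, f u = some a ∧ ∃ u', u' ≠ u ∧ Conflict G w x u' ∧ f u' = some a) ∨
      ∃ i y, IsLink G w y ∧ f y = none ∧ ConflictVia G w x i y ∧ r y < r x) :
    ∃ g, IsLinkColoring G w g ∧ ∀ x, IsLink G w x → g x ≠ none := by
  induction hn : (Finset.univ.filter fun x => IsLink G w x ∧ f x = none).card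
    generalizing f with
  | zero =>
    rw [Finset.card_eq_zero, Finset.filter_eq_empty_iff] at hn
    exact ⟨f, hf, fun x hx h => hn (Finset.mem_univ x) ⟨hx, h⟩⟩
  | succ n ih =>
    have hne : (Finset.univ.filter fun x => IsLink G w x ∧ f x = none).Nonempty := by
      rw [← Finset.card_pos]; omega
    obtain ⟨x, hx, hmax⟩ := Finset.exists_max_image _ r hne
    obtain ⟨hxl, hx0⟩ := (Finset.mem_filter.1 hx).2
    obtain ⟨a, ha⟩ := hf.exists_color hG hw hxl.1 (by
      rcases hr x hxl hx0 with ⟨i, hi⟩ | ⟨i, y, -, hy, hrep, -⟩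
      · refine ⟨i, fun u a hu hua => ?_⟩
        obtain ⟨b, hb, h⟩ := hi u hu
        rw [hua, Option.some.injEq] at hb
        exact hb ▸ h
      · refine ⟨i, fun u a hu hua => ?_⟩
        rw [hu.unique hG hw hxl.1 hrep, hy] at hua
        simp at hua)
    have hext : ∀ u b, f u = some b → Function.update f x (some a) u = some b := by
      intro u b h
      rw [Function.update_of_ne (by rintro rfl; simp [hx0] at h), h]
    refine ih (hf.update hxl ha) (fun y hy hy0 => ?_) ?_
    · have hyx : y ≠ x := by rintro rfl; simp at hy0
      rw [Function.update_of_ne hyx] at hy0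
      rcases hr y hy hy0 with ⟨i, hi⟩ | ⟨i, z, hz, hz0, hrep, hlt⟩
      · refine Or.inl ⟨i, fun u hu => ?_⟩
        obtain ⟨b, hb, u', h1, h2, h3⟩ := hi u hu
        exact ⟨b, hext u b hb, u', h1, h2, hext u' b h3⟩
      · refine Or.inr ⟨i, z, hz, ?_, hrep, hlt⟩
        have hzx : z ≠ x := by
          rintro rfl
          have := hmax y (Finset.mem_filter.2 ⟨Finset.mem_univ y, hy, hy0⟩)
          omega
        rw [Function.update_of_ne hzx, hz0]
    · have : (Finset.univ.filter fun u => IsLink G w u ∧ Function.update f x (some a) u = none) =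
          (Finset.univ.filter fun u => IsLink G w u ∧ f u = none).erase x := by
        ext u
        by_cases hux : u = x <;> simp [hux]
      rw [this, Finset.card_erase_of_mem hx, hn]
      rfl

/-- The conflict graph on the links. -/
def conflictGraph (G : SimpleGraph V) (w : Fin m → V) : SimpleGraph {x // IsLink G w x} where
  Adj x y := Conflict G w x y
  symm := ⟨fun _ _ h => ⟨h.1.symm, h.2.imp (fun h => h.symm)
    (fun ⟨s, h1, h2⟩ => ⟨s, h2.symm, h1.symm⟩)⟩⟩
  loopless := ⟨fun _ h => h.1 rfl⟩

theorem reachable_of_forall_rep (hG : GirthSeven G) (hw : Function.Injective w)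
    {x : {x // IsLink G w x}} (hx : ∀ i, ∃ u, ConflictVia G w x i u) (y : {x // IsLink G w x}) :
    (conflictGraph G w).Reachable x y := by
  have step : ∀ {a b : {x // IsLink G w x}} {s : Fin m}, G.Adj a (w s) → G.Adj b (w s) →
      (conflictGraph G w).Reachable a b := by
    intro a b s ha hb
    by_cases hab : a = b
    · rw [hab]
    · exact SimpleGraph.Adj.reachable
        (show Conflict G w a b from ⟨fun e => hab (Subtype.ext e.symm), Or.inr ⟨s, ha, hb.symm⟩⟩)
  have one : ∀ i, G.Adj y (w i) → (conflictGraph G w).Reachable x y ∨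
      ∃ s, G.Adj x (w s) ∧ G.Adj (w s) (w i) := by
    intro i hi
    obtain ⟨u, hu⟩ := hx i
    have hc := hu.conflict
    rcases hu with ⟨rfl, -, h | h⟩ | ⟨hl, -, ha, -⟩
    · exact Or.inl (step h hi)
    · exact Or.inr h
    · have h1 : (conflictGraph G w).Adj x ⟨u, hl⟩ := hc
      exact Or.inl (h1.reachable.trans (step (a := ⟨u, hl⟩) ha hi))
  obtain ⟨i, j, hij, hi, hj⟩ := y.2.2
  rcases one i hi with h | ⟨s, h1, h2⟩
  · exact h
  rcases one j hj with h | ⟨t, h3, h4⟩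
  · exact h
  by_contra hne
  have hij' : w i ≠ w j := fun e => hij (hw e)
  by_cases hst : s = t
  · subst hst
    exact hG.no4 h2 hi.symm hj h4.symm (y.2.1 s) hij'
  · exact hG.no6 h1 h2 hi.symm hj h4.symm h3.symm (x.2.1 i).symm (y.2.1 s) hij'
      (y.2.1 t).symm (x.2.1 j) (fun e => hst (hw e).symm)

theorem exists_adj_dist_lt {α : Type} {H : SimpleGraph α} {x y : α} (h : H.Reachable x y)
    (hne : x ≠ y) : ∃ z, H.Adj y z ∧ H.dist x z < H.dist x y := by
  obtain ⟨p, hp⟩ := h.symm.exists_walk_length_eq_dist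
  cases p with
  | nil => exact (hne rfl).elim
  | cons hadj q =>
    rename_i z
    refine ⟨z, hadj, ?_⟩
    rw [SimpleGraph.dist_comm, SimpleGraph.dist_comm (u := x), ← hp,
      SimpleGraph.Walk.length_cons]
    exact Nat.lt_succ_of_le (SimpleGraph.dist_le q)

open Classical in
/-- If no link is encircled then all links can be colored. -/
theorem exists_isLinkColoring [Fintype V] (hG : GirthSeven G) (hw : Function.Injective w)
    (hW : ∀ x, IsLink G w x → ¬ Encircles G w x) :
    ∃ g, IsLinkColoring G w g ∧ ∀ x, IsLink G w x → g x ≠ none := by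
  obtain ⟨f, hf, hf0⟩ := exists_isLinkColoring_base (G := G) hw
  by_cases hex : ∃ y : {x // IsLink G w x}, ∀ i, ∃ u, ConflictVia G w y i u
  swap
  · push Not at hex
    refine hf.exists_extension hG hw (fun _ => 0) (fun x hx _ => Or.inl ?_)
    obtain ⟨i, hi⟩ := hex ⟨x, hx⟩
    exact ⟨i, fun u hu => (hi u hu).elim⟩
  obtain ⟨x₀, hx₀⟩ := hex
  have hconn : (conflictGraph G w).Connected := by
    have : Nonempty {x // IsLink G w x} := ⟨x₀⟩
    exact ⟨fun a b => (reachable_of_forall_rep hG hw hx₀ a).symm.trans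
      (reachable_of_forall_rep hG hw hx₀ b)⟩
  by_cases hall : ∀ y : {x // IsLink G w x}, ∀ i, ∃ u, ConflictVia G w y i u
  swap
  · push Not at hall
    obtain ⟨y₀, i₀, hy₀⟩ := hall
    refine hf.exists_extension hG hw
      (fun x => if hx : IsLink G w x then (conflictGraph G w).dist y₀ ⟨x, hx⟩ else 0)
      (fun x hx _ => ?_)
    by_cases hxy : y₀ = ⟨x, hx⟩
    · subst hxy
      exact Or.inl ⟨i₀, fun u hu => (hy₀ u hu).elim⟩
    · obtain ⟨z, hz, hlt⟩ := exists_adj_dist_lt (hconn.preconnected y₀ ⟨x, hx⟩) hxy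
      obtain ⟨i, hi⟩ := Conflict.exists_rep (x := x) (u := z) hz (Or.inr z.2)
      exact Or.inr ⟨i, z, z.2, hf0 z z.2.1, hi, by simpa [hx, z.2] using hlt⟩
  have hnt : Nontrivial {x // IsLink G w x} := by
    have : ∃ y, IsLink G w y ∧ y ≠ x₀ := by
      by_contra! h
      refine hW x₀ x₀.2 (fun i => ?_)
      obtain ⟨u, hu⟩ := hx₀ i
      rcases hu with ⟨rfl, -, h'⟩ | ⟨hl, hne, -⟩
      · exact h'
      · exact (hne (h u hl)).elim
    obtain ⟨y, hy, hne⟩ := this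
    exact ⟨⟨y, hy⟩, x₀, fun e => hne (congrArg Subtype.val e)⟩
  obtain ⟨y, hy⟩ := hconn.exists_connected_induce_compl_singleton_of_finite_nontrivial
  obtain ⟨x, hxy⟩ : ∃ x, (conflictGraph G w).Adj y x := by
    obtain ⟨x, hx⟩ := exists_ne y
    obtain ⟨z, hz, -⟩ := exists_adj_dist_lt (hconn.preconnected x y) hx
    exact ⟨z, hz⟩
  obtain ⟨a, b, hya, hab, hrep⟩ : ∃ a b : Fin m,
      (∀ u, Conflict G w y u → f u ≠ some a) ∧ Conflict G w x (w a) ∧ ConflictVia G w x b y := by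
    have hfw : ∀ {u a}, f u = some a → u = w a := by
      intro u a hu
      by_contra hne
      by_cases h : ∀ i, w i ≠ u
      · simp [hf0 u h] at hu
      · push Not at h
        obtain ⟨i, rfl⟩ := h
        rw [hf.base, Option.some.injEq] at hu
        exact hne (congrArg w hu)
    obtain ⟨hne, h | ⟨s, h1, h2⟩⟩ := hxy
    · obtain ⟨a, -, -, ha, -⟩ := x.2.2
      obtain ⟨b, -, -, hb, -⟩ := y.2.2
      refine ⟨a, b, fun u hu hua => ?_, ⟨x.2.1 a, Or.inl ha⟩,
        Or.inr ⟨y.2, hne.symm, hb, Or.inl h.symm⟩⟩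
      obtain rfl := hfw hua
      rcases hu.2 with h' | ⟨t, h3, h4⟩
      · exact hG.no3 h ha h'.symm
      · exact hG.no4 h3 h4 ha.symm h.symm (y.2.1 a).symm (x.2.1 t)
    · have other : ∀ z : {x // IsLink G w x}, ∃ a, a ≠ s ∧ G.Adj z (w a) := by
        intro z
        obtain ⟨i, j, hij, hi, hj⟩ := z.2.2
        by_cases his : i = s
        · exact ⟨j, his ▸ hij.symm, hj⟩
        · exact ⟨i, his, hi⟩
      obtain ⟨a, has, ha⟩ := other x
      obtain ⟨b, hbs, hb⟩ := other y
      refine ⟨a, b, fun u hu hua => ?_, ⟨x.2.1 a, Or.inl ha⟩,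
        Or.inr ⟨y.2, hne.symm, hb, Or.inr ⟨s, hbs.symm, h2.symm, h1.symm⟩⟩⟩
      obtain rfl := hfw hua
      rcases hu.2 with h' | ⟨t, h3, h4⟩
      · exact hG.no4 h1 h2 ha h'.symm hne.symm (fun e => has (hw e).symm)
      · exact hG.no5 h1 h2 ha h4.symm h3.symm
  have hyx : (x : V) ≠ y := hxy.1
  have hf' := hf.update y.2 hya
  set T := (conflictGraph G w).induce ({y}ᶜ : Set {x // IsLink G w x}) with hT
  have hmem : ∀ z : V, ∀ hz : IsLink G w z, z ≠ y →
      (⟨z, hz⟩ : {x // IsLink G w x}) ∈ ({y}ᶜ : Set {x // IsLink G w x}) := by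
    intro z hz hne h
    exact hne (congrArg Subtype.val h)
  refine hf'.exists_extension hG hw (fun z => if hz : IsLink G w z ∧ z ≠ y then
    T.dist ⟨x, hmem x x.2 hyx⟩ ⟨⟨z, hz.1⟩, hmem z hz.1 hz.2⟩ else 0) (fun z hz hz0 => ?_)
  have hzy : z ≠ y := by rintro rfl; simp at hz0
  by_cases hzx : z = x
  · refine Or.inl ⟨b, fun u hu => ⟨a, ?_, w a, ?_, ?_, ?_⟩⟩
    · rw [hzx] at hu
      rw [hu.unique hG hw x.2.1 hrep, Function.update_self]
    · rw [hzx] at hu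
      rw [hu.unique hG hw x.2.1 hrep]
      exact y.2.1 a
    · rw [hzx]; exact hab
    · exact hf'.base a
  · obtain ⟨t, ht, hlt⟩ := exists_adj_dist_lt
      (hy.preconnected ⟨x, hmem x x.2 hyx⟩ ⟨⟨z, hz⟩, hmem z hz hzy⟩)
      (fun e => hzx (congrArg (fun t => (t.1 : V)) e).symm)
    have hcon : Conflict G w z t.1 := ht
    have hty : (t.1 : V) ≠ y := fun e => t.2 (Subtype.ext e)
    obtain ⟨i, hi⟩ := hcon.exists_rep (Or.inr t.1.2)
    refine Or.inr ⟨i, t.1, t.1.2, ?_, hi, ?_⟩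
    · rw [Function.update_of_ne hty]
      exact hf0 _ t.1.2.1
    · simp only [hz, hzy, t.1.2, hty, ne_eq, not_false_eq_true, and_self, dite_true]
      exact hlt

end LinkColoring

/-- Some neighbour of `w i` has been given the color `a`. -/
def Seen {V : Type} (G : SimpleGraph V) {m : ℕ} (w : Fin m → V) (f : V → Option (Fin m))
    (i a : Fin m) : Prop :=
  ∃ u, G.Adj (w i) u ∧ f u = some a

/-- `u` is the second vertex of a path of length at most three from `w i` to `w j`. -/
def Near {V : Type} (G : SimpleGraph V) {m : ℕ} (w : Fin m → V) (i j : Fin m) (u : V) : Prop :=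
  G.Adj (w i) u ∧
    (u = w j ∨ G.Adj u (w j) ∨ ∃ y, y ≠ w i ∧ G.Adj u y ∧ G.Adj y (w j))

open Classical in
/-- The colors other than `i` that no neighbour of `w i` has. -/
noncomputable def missing {V : Type} (G : SimpleGraph V) {m : ℕ} (w : Fin m → V)
    (f : V → Option (Fin m)) (i : Fin m) : Finset (Fin m) :=
  Finset.univ.filter fun a => a ≠ i ∧ ¬ Seen G w f i a

open Classical in
/-- The uncolored neighbours of `v`. -/
noncomputable def uncoloredNbrs {V : Type} [Fintype V] (G : SimpleGraph V) {m : ℕ}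
    (f : V → Option (Fin m)) (v : V) : Finset V :=
  Finset.univ.filter fun u => G.Adj v u ∧ f u = none

open Classical in
/-- The colored neighbours of `v`. -/
noncomputable def coloredNbrs {V : Type} [Fintype V] (G : SimpleGraph V) {m : ℕ}
    (f : V → Option (Fin m)) (v : V) : Finset V :=
  Finset.univ.filter fun u => G.Adj v u ∧ f u ≠ none

section Saturation

variable {V : Type} {G : SimpleGraph V} {m : ℕ} {w : Fin m → V}

theorem Near.unique (hG : GirthSeven G) {i j : Fin m} (hij : w i ≠ w j) {u u' : V}
    (h : Near G w i j u) (h' : Near G w i j u') : u = u' := by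
  have key : ∀ {u u'}, Near G w i j u → Near G w i j u' → u ≠ w j → u' ≠ w j → u = u' := by
    rintro u u' ⟨h, hu⟩ ⟨h', hu'⟩ hne hne'
    by_contra huu
    rcases hu with hu | hu | ⟨y, hy, h1, h2⟩
    · exact hne hu
    · rcases hu' with hu' | hu' | ⟨y', hy', h3, h4⟩
      · exact hne' hu'
      · exact hG.no4 h hu hu'.symm h'.symm hij huu
      · exact hG.no5 h hu h4.symm h3.symm h'.symm
    · rcases hu' with hu' | hu' | ⟨y', hy', h3, h4⟩
      · exact hne' hu'
      · exact hG.no5 h' hu' h2.symm h1.symm h.symm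
      · by_cases hyy : y = y'
        · subst hyy
          exact hG.no4 h h1 h3.symm h'.symm hy.symm huu
        · exact hG.no6 h h1 h2 h4.symm h3.symm h'.symm hy.symm hne hyy hne'.symm hy'
            (fun e => huu e.symm)
  have one : ∀ {u}, G.Adj (w i) (w j) → Near G w i j u → u = w j := by
    rintro u hadj ⟨h, hu⟩
    by_contra hne
    rcases hu with hu | hu | ⟨y, hy, h1, h2⟩
    · exact hne hu
    · exact hG.no3 h hu hadj.symm
    · exact hG.no4 h h1 h2 hadj.symm hy.symm hne
  by_cases h1 : u = w j
  · have hadj := h1 ▸ h.1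
    rw [h1, one hadj h']
  · by_cases h2 : u' = w j
    · have hadj := h2 ▸ h'.1
      rw [h2, one hadj h]
    · exact key h h' h1 h2

theorem GirthSeven.mid_unique (hG : GirthSeven G) {x y y' z : V} (h1 : G.Adj x y)
    (h2 : G.Adj y z) (h1' : G.Adj x y') (h2' : G.Adj y' z) (hxz : x ≠ z) : y = y' := by
  by_contra h
  exact hG.no4 h1 h2 h2'.symm h1'.symm hxz h

theorem mem_missing {f : V → Option (Fin m)} {i a : Fin m} :
    a ∈ missing G w f i ↔ a ≠ i ∧ ¬ Seen G w f i a := by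
  classical
  simp [missing]

variable [Fintype V]

theorem mem_uncoloredNbrs {f : V → Option (Fin m)} {v u : V} :
    u ∈ uncoloredNbrs G f v ↔ G.Adj v u ∧ f u = none := by
  classical
  simp [uncoloredNbrs]

theorem mem_coloredNbrs {f : V → Option (Fin m)} {v u : V} :
    u ∈ coloredNbrs G f v ↔ G.Adj v u ∧ f u ≠ none := by
  classical
  simp [coloredNbrs]

theorem card_coloredNbrs_add (f : V → Option (Fin m)) (v : V) :
    (coloredNbrs G f v).card + (uncoloredNbrs G f v).card = dg G v := by
  classical
  unfold dg coloredNbrs uncoloredNbrs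
  rw [← Finset.card_union_of_disjoint]
  · congr 1
    ext u
    simp only [Finset.mem_union, Finset.mem_filter, Finset.mem_univ, true_and]
    tauto
  · rw [Finset.disjoint_left]
    intro u
    simp only [Finset.mem_filter, Finset.mem_univ, true_and]
    tauto

open Classical in
/-- If at most `m - 1` colored neighbours and forbidden pairs are visible around `w i`, then
its uncolored neighbours can be given all the colors it misses. -/
theorem exists_saturation_step (hG : GirthSeven G) (hw : Function.Injective w)
    {f : V → Option (Fin m)} (hbase : ∀ i, f (w i) = some i) (hf : PProper G f) {i j₀ : Fin m}
    (hd : m ≤ dg G (w i) ∨ j₀ ≠ i ∧ m ≤ dg G (w i) + 1)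
    (ha : ∀ u, G.Adj (w i) u → f u ≠ none → ∃ j, j ≠ i ∧ j ≠ j₀ ∧ Near G w i j u)
    (hb : ∀ x y a, G.Adj (w i) x → f x = none → G.Adj x y → f y = some a → a ≠ i →
      Seen G w f i a ∨ ∃ j, j ≠ i ∧ j ≠ j₀ ∧ G.Adj y (w j))
    (hc : (missing G w f i).card ≤ (uncoloredNbrs G f (w i)).card) :
    ∃ f' : V → Option (Fin m), (∀ u a, f u = some a → f' u = some a) ∧ PProper G f' ∧
      (∀ u, f u = none → f' u ≠ none → G.Adj (w i) u) ∧ ∀ a, a ≠ i → Seen G w f' i a := by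
  set K := coloredNbrs G f (w i) with hK
  set F := uncoloredNbrs G f (w i) with hF
  set A := missing G w f i with hA
  set X : Finset (V × Fin m) := Finset.univ.filter fun p =>
    (G.Adj (w i) p.1 ∧ f p.1 = none) ∧ p.2 ∈ A ∧ ∃ y, G.Adj p.1 y ∧ f y = some p.2 with hX
  set J : Finset (Fin m) := Finset.univ.filter fun j => j ≠ i ∧ j ≠ j₀ with hJ
  have hXi : ∀ p : V × Fin m, p ∈ X → ∃ j y, j ≠ i ∧ j ≠ j₀ ∧ Near G w i j p.1 ∧
      G.Adj p.1 y ∧ G.Adj y (w j) ∧ f y = some p.2 := by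
    rintro ⟨x, a⟩ hp
    obtain ⟨⟨h1, h2⟩, h3, y, h4, h5⟩ := (Finset.mem_filter.1 hp).2
    dsimp only at h1 h2 h3 h4 h5
    rw [hA, mem_missing] at h3
    obtain ⟨j, hj, hj', hjy⟩ := (hb x y a h1 h2 h4 h5 h3.1).resolve_left h3.2
    refine ⟨j, y, hj, hj', ⟨h1, Or.inr (Or.inr ⟨y, ?_, h4, hjy⟩)⟩, h4, hjy, h5⟩
    rintro rfl
    rw [hbase, Option.some.injEq] at h5
    exact h3.1 h5.symm
  have hKi : ∀ u, u ∈ K → ∃ j, j ≠ i ∧ j ≠ j₀ ∧ Near G w i j u := by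
    intro u hu
    rw [hK, mem_coloredNbrs] at hu
    exact ha u hu.1 hu.2
  have hcount : K.card + X.card ≤ J.card := by
    have : Nonempty (Fin m) := ⟨i⟩
    have : Nonempty V := ⟨w i⟩
    choose! κ hκ using hKi
    choose! ξ y hξ using hXi
    rw [← Finset.card_disjSum]
    refine Finset.card_le_card_of_injOn (Sum.elim κ ξ) ?_ ?_
    · rintro (u | p) hu
      · have := hκ u (by simpa using hu)
        simp [hJ, this.1, this.2.1]
      · have := hξ p (by simpa using hu)
        simp [hJ, this.1, this.2.1]
    · have hnej : ∀ j, j ≠ i → w i ≠ w j := fun j hj e => hj (hw e).symm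
      have hcross : ∀ u p, u ∈ K → p ∈ X → κ u = ξ p → False := by
        intro u p hu hp h
        have h1 := hκ u hu
        have h2 := hξ p hp
        rw [h] at h1
        have h3 := h1.2.2.unique hG (hnej _ h2.1) h2.2.2.1
        rw [hK, mem_coloredNbrs] at hu
        exact hu.2 (h3 ▸ (Finset.mem_filter.1 hp).2.1.2)
      rintro (u | p) hu (u' | p') hu' h
      · have h1 := hκ u (by simpa using hu)
        have h2 := hκ u' (by simpa using hu')
        rw [← show κ u = κ u' from h] at h2
        rw [h1.2.2.unique hG (hnej _ h1.1) h2.2.2]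
      · exact (hcross u p' (by simpa using hu) (by simpa using hu') h).elim
      · exact (hcross u' p (by simpa using hu') (by simpa using hu) h.symm).elim
      · have h1 := hξ p (by simpa using hu)
        have h2 := hξ p' (by simpa using hu')
        rw [← show ξ p = ξ p' from h] at h2
        have hp : p ∈ X := by simpa using hu
        obtain ⟨⟨-, hx0⟩, -⟩ := (Finset.mem_filter.1 hp).2
        have hx : p.1 = p'.1 := h1.2.2.1.unique hG (hnej _ h1.1) h2.2.2.1
        have hxj : p.1 ≠ w (ξ p) := by
          intro e
          rw [e, hbase] at hx0
          simp at hx0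
        have hy : y p = y p' := hG.mid_unique h1.2.2.2.1 h1.2.2.2.2.1 (hx ▸ h2.2.2.2.1)
          h2.2.2.2.2.1 hxj
        have ha' : p.2 = p'.2 := by
          have e1 := h1.2.2.2.2.2
          rw [hy, h2.2.2.2.2.2, Option.some.injEq] at e1
          exact e1.symm
        exact congrArg Sum.inr (Prod.ext hx ha')
  have hKF : K.card + F.card = dg G (w i) := card_coloredNbrs_add f (w i)
  have hJc : J.card < dg G (w i) := by
    have hJ1 : J ⊆ Finset.univ.erase i := fun j hj => by
      simp only [hJ, Finset.mem_filter] at hj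
      simp [hj.2.1]
    have h1 := Finset.card_le_card hJ1
    have hm : 0 < m := i.pos
    rw [Finset.card_erase_of_mem (Finset.mem_univ i), Finset.card_univ, Fintype.card_fin] at h1
    rcases hd with hd | ⟨hne, hd⟩
    · omega
    · have hJ2 : J ⊆ (Finset.univ.erase i).erase j₀ := fun j hj => by
        simp only [hJ, Finset.mem_filter] at hj
        simp [hj.2.1, hj.2.2]
      have h2 := Finset.card_le_card hJ2
      have hm2 : 2 ≤ m := by
        have := Fintype.one_lt_card_iff.2 ⟨j₀, i, hne⟩
        rwa [Fintype.card_fin] at this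
      rw [Finset.card_erase_of_mem (by simp [hne]), Finset.card_erase_of_mem (Finset.mem_univ i),
        Finset.card_univ, Fintype.card_fin] at h2
      omega
  obtain ⟨g, hg, hg'⟩ := exists_matching_avoiding F A X hc (by omega)
  have hgF : ∀ a, G.Adj (w i) (g a) ∧ f (g a) = none := fun a => by
    have := (hg' a).1
    rwa [hF, mem_uncoloredNbrs] at this
  set f' : V → Option (Fin m) := fun u => if h : ∃ a, g a = u then some h.choose.1 else f u
    with hf'
  have hnew : ∀ a, f' (g a) = some a.1 := by
    intro a
    have h : ∃ b, g b = g a := ⟨a, rfl⟩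
    simp only [hf', dif_pos h]
    rw [hg h.choose_spec]
  have hold : ∀ u, (∀ a, g a ≠ u) → f' u = f u := by
    intro u hu
    exact dif_neg (by push Not; exact hu)
  refine ⟨f', fun u a hu => ?_, fun u v a huv hu hv => ?_, fun u hu hu' => ?_, fun a hai => ?_⟩
  · rw [hold, hu]
    rintro b rfl
    rw [(hgF b).2] at hu
    simp at hu
  · have mixed : ∀ b v, G.Adj (g b) v → f v ≠ some b.1 := by
      intro b v hbv hv
      exact (hg' b).2 (Finset.mem_filter.2 ⟨Finset.mem_univ _, hgF b, b.2, v, hbv, hv⟩)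
    by_cases h1 : ∃ b, g b = u
    · obtain ⟨b, rfl⟩ := h1
      rw [hnew, Option.some.injEq] at hu
      by_cases h2 : ∃ b, g b = v
      · obtain ⟨b', rfl⟩ := h2
        exact hG.no3 (hgF b).1 huv (hgF b').1.symm
      · push Not at h2
        rw [hold v h2] at hv
        exact mixed b v huv (hu ▸ hv)
    · push Not at h1
      rw [hold u h1] at hu
      by_cases h2 : ∃ b, g b = v
      · obtain ⟨b', rfl⟩ := h2
        rw [hnew, Option.some.injEq] at hv
        exact mixed b' u huv.symm (hv ▸ hu)
      · push Not at h2
        rw [hold v h2] at hv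
        exact hf u v a huv hu hv
  · by_cases h1 : ∃ b, g b = u
    · obtain ⟨b, rfl⟩ := h1
      exact (hgF b).1
    · push Not at h1
      rw [hold u h1] at hu'
      exact (hu' hu).elim
  · by_cases ha' : a ∈ A
    · exact ⟨g ⟨a, ha'⟩, (hgF _).1, hnew ⟨a, ha'⟩⟩
    · rw [hA, mem_missing] at ha'
      push Not at ha'
      obtain ⟨u, hu, hua⟩ := ha' hai
      refine ⟨u, hu, ?_⟩
      rw [hold, hua]
      rintro b rfl
      rw [(hgF b).2] at hua
      simp at hua

/-- What is needed of the initial coloring `f` so that `w i` can be processed after the members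
of `Q` of rank larger than `r i`. -/
def Processable (G : SimpleGraph V) {m : ℕ} (w : Fin m → V) (f : V → Option (Fin m))
    (Q : Finset (Fin m)) (r : Fin m → ℕ) (i : Fin m) : Prop :=
  (∀ a, a ≠ i → Seen G w f i a) ∨
  (missing G w f i).card ≤ (uncoloredNbrs G f (w i)).card ∧
  ∃ j₀, (m ≤ dg G (w i) ∨ j₀ ≠ i ∧ m ≤ dg G (w i) + 1) ∧
    (∀ u, G.Adj (w i) u → f u ≠ none → ∃ j, j ≠ i ∧ j ≠ j₀ ∧ Near G w i j u) ∧
    (∀ x y a, G.Adj (w i) x → f x = none → G.Adj x y → f y = some a → a ≠ i →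
      Seen G w f i a ∨ ∃ j, j ≠ i ∧ j ≠ j₀ ∧ G.Adj y (w j)) ∧
    (∀ x y, G.Adj (w i) x → f x = none → G.Adj x y → f y = none → G.Adj y (w j₀) →
      j₀ ∈ Q → r j₀ < r i)

open Classical in
theorem exists_saturation (hG : GirthSeven G) (hw : Function.Injective w)
    {f : V → Option (Fin m)} (hbase : ∀ i, f (w i) = some i) (hf : PProper G f)
    (hfull : ∀ x, IsLink G w x → f x ≠ none) (Q : Finset (Fin m)) (r : Fin m → ℕ)
    (hQ : ∀ i ∈ Q, Processable G w f Q r i) :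
    ∃ g : V → Option (Fin m), (∀ u a, f u = some a → g u = some a) ∧ PProper G g ∧
      ∀ i ∈ Q, ∀ a, a ≠ i → Seen G w g i a := by
  suffices H : ∀ n, ∀ P ⊆ Q, (Q \ P).card = n → (∀ p ∈ P, ∀ q ∈ Q, q ∉ P → r q ≤ r p) →
      ∀ h : V → Option (Fin m), (∀ u a, f u = some a → h u = some a) → PProper G h →
      (∀ u, f u = none → h u ≠ none → ∃ p ∈ P, G.Adj (w p) u) →
      (∀ i ∈ P, ∀ a, a ≠ i → Seen G w h i a) →
      ∃ g : V → Option (Fin m), (∀ u a, f u = some a → g u = some a) ∧ PProper G g ∧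
        ∀ i ∈ Q, ∀ a, a ≠ i → Seen G w g i a from
    H _ ∅ (by simp) rfl (by simp) f (fun _ _ h => h) hf (fun u h1 h2 => (h2 h1).elim) (by simp)
  intro n
  induction n with
  | zero =>
    intro P hP hn hr h hext hprop hnew hseen
    have : Q ⊆ P := by rwa [Finset.card_eq_zero, Finset.sdiff_eq_empty_iff_subset] at hn
    exact ⟨h, hext, hprop, fun i hi => hseen i (this hi)⟩
  | succ n ih =>
    intro P hP hn hr h hext hprop hnew hseen
    obtain ⟨i, hi, hmax⟩ := Finset.exists_max_image (Q \ P) r (by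
      rw [← Finset.card_pos]; omega)
    obtain ⟨hiQ, hiP⟩ := Finset.mem_sdiff.1 hi
    have hstep : ∃ g : V → Option (Fin m), (∀ u a, h u = some a → g u = some a) ∧ PProper G g ∧
        (∀ u, h u = none → g u ≠ none → G.Adj (w i) u) ∧ ∀ a, a ≠ i → Seen G w g i a := by
      rcases hQ i hiQ with hall | ⟨hc, j₀, hd, ha, hb, hb'⟩
      · refine ⟨h, fun _ _ h => h, hprop, fun u h1 h2 => (h2 h1).elim, fun a hai => ?_⟩
        obtain ⟨u, hu, hua⟩ := hall a hai
        exact ⟨u, hu, hext u a hua⟩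
      have hnbr : ∀ u, G.Adj (w i) u → h u = f u := by
        intro u hu
        cases hfu : f u with
        | some a => exact hext u a hfu
        | none =>
          by_contra hne
          obtain ⟨p, hp, hpu⟩ := hnew u hfu hne
          refine hfull u ⟨fun s hs => ?_, i, p, fun e => hiP (e ▸ hp), hu.symm, hpu.symm⟩ hfu
          rw [← hs, hbase] at hfu
          simp at hfu
      have hS : ∀ a, Seen G w h i a ↔ Seen G w f i a := fun a =>
        exists_congr fun u => and_congr_right fun hu => by rw [hnbr u hu]
      refine exists_saturation_step (j₀ := j₀) hG hw (fun s => hext _ _ (hbase s)) hprop hd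
        (fun u hu hu0 => ha u hu (by rwa [hnbr u hu] at hu0)) (fun x y a hx hx0 hxy hy hai => ?_) ?_
      · rw [hnbr x hx] at hx0
        rw [hS]
        cases hfy : f y with
        | some b =>
          rw [hext y b hfy, Option.some.injEq] at hy
          exact hb x y a hx hx0 hxy (hy ▸ hfy) hai
        | none =>
          obtain ⟨p, hp, hpy⟩ := hnew y hfy (by simp [hy])
          refine Or.inr ⟨p, fun e => hiP (e ▸ hp), fun e => ?_, hpy.symm⟩
          have h1 := hb' x y hx hx0 hxy hfy (e ▸ hpy.symm) (e ▸ hP hp)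
          have h2 := hr p hp i hiQ hiP
          rw [e] at h2
          omega
      · have e1 : missing G w h i = missing G w f i := by
          ext a
          rw [mem_missing, mem_missing, hS]
        have e2 : uncoloredNbrs G h (w i) = uncoloredNbrs G f (w i) := by
          ext u
          rw [mem_uncoloredNbrs, mem_uncoloredNbrs]
          exact and_congr_right fun hu => by rw [hnbr u hu]
        rwa [e1, e2]
    obtain ⟨g, hg1, hg2, hg3, hg4⟩ := hstep
    refine ih (insert i P) (Finset.insert_subset hiQ hP) ?_ ?_ g
      (fun u a hu => hg1 u a (hext u a hu)) hg2 ?_ ?_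
    · rw [Finset.sdiff_insert, Finset.card_erase_of_mem hi, hn]
      rfl
    · intro p hp q hq hqP
      rw [Finset.mem_insert, not_or] at hqP
      rcases Finset.mem_insert.1 hp with rfl | hp
      · exact hmax q (Finset.mem_sdiff.2 ⟨hq, hqP.2⟩)
      · exact hr p hp q hq hqP.2
    · intro u hu hgu
      by_cases hhu : h u = none
      · exact ⟨i, Finset.mem_insert_self i P, hg3 u hhu hgu⟩
      · obtain ⟨p, hp, hpu⟩ := hnew u hu hhu
        exact ⟨p, Finset.mem_insert_of_mem hp, hpu⟩
    · intro p hp a ha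
      rcases Finset.mem_insert.1 hp with rfl | hp
      · exact hg4 a ha
      · obtain ⟨u, hu, hua⟩ := hseen p hp a ha
        exact ⟨u, hu, hg1 u a hua⟩

end Saturation

/-- A coloring of the family `w` and of all its links that is proper and, apart from the colors of
`e` and its twins around `w v₀`, gives different colors to the colored neighbours of each `w i`. -/
structure IsPrecoloring {V : Type} (G : SimpleGraph V) {m : ℕ} (w : Fin m → V) (v₀ : Fin m)
    (e : V) (f : V → Option (Fin m)) : Prop where
  base : ∀ i, f (w i) = some i
  proper : PProper G f
  rainbow : ∀ {i u u' a}, (i = v₀ → u ≠ e ∧ u' ≠ e) → G.Adj (w i) u → G.Adj (w i) u' →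
    f u = some a → f u' = some a → u = u'
  full : ∀ {u}, IsLink G w u → f u ≠ none

/-- A vertex outside the family `w` with at most one neighbour in it. -/
def IsLoose {V : Type} (G : SimpleGraph V) {m : ℕ} (w : Fin m → V) (x : V) : Prop :=
  (∀ i, w i ≠ x) ∧ ¬ IsLink G w x

/-- `w i` and `w j` are adjacent or joined by a link that has no other neighbour in `w`. -/
def Tied {V : Type} (G : SimpleGraph V) {m : ℕ} (w : Fin m → V) (i j : Fin m) : Prop :=
  G.Adj (w i) (w j) ∨ ∃ u, IsLink G w u ∧ ∀ s, G.Adj u (w s) ↔ s = i ∨ s = j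

/-- `w i` and `w j` are joined by a path of length three through loose vertices. -/
def Threaded {V : Type} (G : SimpleGraph V) {m : ℕ} (w : Fin m → V) (i j : Fin m) : Prop :=
  ∃ x y, IsLoose G w x ∧ IsLoose G w y ∧ G.Adj (w i) x ∧ G.Adj x y ∧ G.Adj y (w j)

section Core

variable {V : Type} {G : SimpleGraph V} {m : ℕ} {w : Fin m → V}

theorem IsLink.exists_ne {u : V} (h : IsLink G w u) (i : Fin m) : ∃ j, j ≠ i ∧ G.Adj u (w j) := by
  obtain ⟨a, b, hab, ha, hb⟩ := h.2
  by_cases h : a = i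
  · exact ⟨b, h ▸ hab.symm, hb⟩
  · exact ⟨a, h, ha⟩

theorem IsLoose.eq_of_adj {x : V} (h : IsLoose G w x) {i j : Fin m} (hi : G.Adj x (w i))
    (hj : G.Adj x (w j)) : i = j := by
  by_contra hne
  exact h.2 ⟨h.1, i, j, hne, hi, hj⟩

theorem Threaded.near {i j : Fin m} (h : Threaded G w i j) : ∃ x, IsLoose G w x ∧ Near G w i j x := by
  obtain ⟨x, y, hx, hy, h1, h2, h3⟩ := h
  exact ⟨x, hx, h1, Or.inr (Or.inr ⟨y, (hy.1 i).symm, h2, h3⟩)⟩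

theorem Tied.near {i j : Fin m} (h : Tied G w i j) : ∃ x, ¬ IsLoose G w x ∧ Near G w i j x := by
  rcases h with h | ⟨u, hu, hs⟩
  · exact ⟨w j, fun h => h.1 j rfl, h, Or.inl rfl⟩
  · exact ⟨u, fun h => h.2 hu, ((hs i).2 (Or.inl rfl)).symm, Or.inr (Or.inl ((hs j).2 (Or.inr rfl)))⟩

theorem Tied.not_threaded (hG : GirthSeven G) (hw : Function.Injective w) {i j : Fin m}
    (hij : i ≠ j) (h : Tied G w i j) : ¬ Threaded G w i j := by
  intro h'
  obtain ⟨x, hx, hx'⟩ := h.near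
  obtain ⟨y, hy, hy'⟩ := h'.near
  exact hx (hx'.unique hG (fun e => hij (hw e)) hy' ▸ hy)

theorem Tied.not_tied (hG : GirthSeven G) (hw : Function.Injective w) {i j k : Fin m}
    (hij : i ≠ j) (hik : i ≠ k) (hjk : j ≠ k) (h1 : Tied G w i k) (h2 : Tied G w j k) :
    ¬ Tied G w i j := by
  intro h3
  have wij : w i ≠ w j := fun e => hij (hw e)
  have wik : w i ≠ w k := fun e => hik (hw e)
  have wjk : w j ≠ w k := fun e => hjk (hw e)
  rcases h1 with h1 | ⟨u, hu, hs⟩ <;> rcases h2 with h2 | ⟨u', hu', hs'⟩ <;>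
    rcases h3 with h3 | ⟨u'', hu'', hs''⟩
  · exact hG.no3 h3 h2 h1.symm
  · have a1 := (hs'' i).2 (Or.inl rfl)
    have a2 := (hs'' j).2 (Or.inr rfl)
    exact hG.no4 a1.symm a2 h2 h1.symm wij (hu''.1 k).symm
  · have a1 := (hs' j).2 (Or.inl rfl)
    have a2 := (hs' k).2 (Or.inr rfl)
    exact hG.no4 h3 a1.symm a2 h1.symm (hu'.1 i) wjk
  · have a1 := (hs'' i).2 (Or.inl rfl)
    have a2 := (hs'' j).2 (Or.inr rfl)
    have a3 := (hs' j).2 (Or.inl rfl)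
    have a4 := (hs' k).2 (Or.inr rfl)
    exact hG.no5 a1.symm a2 a3.symm a4 h1.symm
  · have a1 := (hs i).2 (Or.inl rfl)
    have a2 := (hs k).2 (Or.inr rfl)
    exact hG.no4 h3 h2 a2.symm a1 wik (hu.1 j)
  · have a1 := (hs'' i).2 (Or.inl rfl)
    have a2 := (hs'' j).2 (Or.inr rfl)
    have a3 := (hs i).2 (Or.inl rfl)
    have a4 := (hs k).2 (Or.inr rfl)
    exact hG.no5 a1.symm a2 h2 a4.symm a3
  · have a1 := (hs' j).2 (Or.inl rfl)
    have a2 := (hs' k).2 (Or.inr rfl)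
    have a3 := (hs i).2 (Or.inl rfl)
    have a4 := (hs k).2 (Or.inr rfl)
    exact hG.no5 h3 a1.symm a2 a4.symm a3
  · have a1 := (hs'' i).2 (Or.inl rfl)
    have a2 := (hs'' j).2 (Or.inr rfl)
    have a3 := (hs' j).2 (Or.inl rfl)
    have a4 := (hs' k).2 (Or.inr rfl)
    have a5 := (hs i).2 (Or.inl rfl)
    have a6 := (hs k).2 (Or.inr rfl)
    refine hG.no6 a1.symm a2 a3.symm a4 a6.symm a5 wij ?_ wjk ?_ wik.symm ?_
    · rintro rfl
      exact ((hs'' k).1 a4).elim hik.symm hjk.symm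
    · rintro rfl
      exact ((hs j).1 a3).elim hij.symm hjk
    · rintro rfl
      exact ((hs'' k).1 a6).elim hik.symm hjk.symm

variable [Fintype V]

theorem missing_add_card_le {f : V → Option (Fin m)} (hbase : ∀ i, f (w i) = some i)
    (hf : PProper G f) {i : Fin m} (T : Finset V) (hT : T ⊆ coloredNbrs G f (w i))
    (hinj : ∀ u ∈ T, ∀ u' ∈ T, ∀ a, f u = some a → f u' = some a → u = u') :
    (missing G w f i).card + T.card + 1 ≤ m := by
  classical
  have h1 : ∀ u ∈ T, ∃ a, f u = some a := fun u hu =>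
    Option.ne_none_iff_exists'.1 (mem_coloredNbrs.1 (hT hu)).2
  have : Nonempty (Fin m) := ⟨i⟩
  choose! κ hκ using h1
  have h2 : (T.image κ).card = T.card := Finset.card_image_of_injOn fun u hu u' hu' h =>
    hinj u hu u' hu' (κ u) (hκ u hu) ((show κ u = κ u' from h) ▸ hκ u' hu')
  have h3 : Disjoint (missing G w f i) (T.image κ) := by
    rw [Finset.disjoint_left]
    intro a ha ha'
    obtain ⟨u, hu, rfl⟩ := Finset.mem_image.1 ha'
    exact (mem_missing.1 ha).2 ⟨u, (mem_coloredNbrs.1 (hT hu)).1, hκ u hu⟩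
  have h4 : missing G w f i ∪ T.image κ ⊆ Finset.univ.erase i := by
    intro a ha
    rw [Finset.mem_erase]
    refine ⟨?_, Finset.mem_univ a⟩
    rcases Finset.mem_union.1 ha with ha | ha
    · exact (mem_missing.1 ha).1
    · obtain ⟨u, hu, rfl⟩ := Finset.mem_image.1 ha
      intro h
      exact hf _ u i (mem_coloredNbrs.1 (hT hu)).1 (hbase i) (h ▸ hκ u hu)
  have h5 := Finset.card_le_card h4
  rw [Finset.card_union_of_disjoint h3, h2, Finset.card_erase_of_mem (Finset.mem_univ i),
    Finset.card_univ, Fintype.card_fin] at h5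
  have := i.pos
  omega

theorem le_missing_add_card (f : V → Option (Fin m)) (i : Fin m) :
    m ≤ (missing G w f i).card + (coloredNbrs G f (w i)).card + 1 := by
  classical
  have h1 : ∀ a, a ∈ Finset.univ.erase i \ missing G w f i →
      ∃ u, G.Adj (w i) u ∧ f u = some a := by
    intro a ha
    rw [Finset.mem_sdiff, mem_missing, Finset.mem_erase] at ha
    by_contra h
    exact ha.2 ⟨ha.1.1, h⟩
  have : Nonempty V := ⟨w i⟩
  choose! u hu hu' using h1
  have h2 := Finset.card_le_card_of_injOn (t := coloredNbrs G f (w i)) u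
    (fun a ha => mem_coloredNbrs.2 ⟨hu a ha, by simp [hu' a ha]⟩)
    (fun a ha b hb h => by
      have h3 := hu' a ha
      rw [show u a = u b from h, hu' b hb, Option.some.injEq] at h3
      exact h3.symm)
  have h3 := Finset.le_card_sdiff (missing G w f i) (Finset.univ.erase i)
  rw [Finset.card_erase_of_mem (Finset.mem_univ i), Finset.card_univ, Fintype.card_fin] at h3
  omega

theorem IsPrecoloring.missing_le {v₀ : Fin m} {e : V} {f : V → Option (Fin m)}
    (hf : IsPrecoloring G w v₀ e f) {i : Fin m} (hd : m ≤ dg G (w i) + 1)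
    (hv : i ≠ v₀ ∨ m ≤ dg G (w v₀)) :
    (missing G w f i).card ≤ (uncoloredNbrs G f (w i)).card := by
  classical
  have h := card_coloredNbrs_add (G := G) f (w i)
  by_cases hi : i = v₀
  · subst hi
    have h1 := missing_add_card_le hf.base hf.proper ((coloredNbrs G f (w i)).erase e)
      (Finset.erase_subset _ _) (fun u hu u' hu' a ha ha' => by
        rw [Finset.mem_erase] at hu hu'
        exact hf.rainbow (fun _ => ⟨hu.1, hu'.1⟩) (mem_coloredNbrs.1 hu.2).1
          (mem_coloredNbrs.1 hu'.2).1 ha ha')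
    have h2 := Finset.pred_card_le_card_erase (a := e) (s := coloredNbrs G f (w i))
    have h3 := hv.resolve_left (fun h => h rfl)
    omega
  · have h1 := missing_add_card_le hf.base hf.proper (coloredNbrs G f (w i)) subset_rfl
      (fun u hu u' hu' a ha ha' => hf.rainbow (fun h => (hi h).elim) (mem_coloredNbrs.1 hu).1
          (mem_coloredNbrs.1 hu').1 ha ha')
    omega

theorem Processable.of_index {f : V → Option (Fin m)} (hG : GirthSeven G)
    (hbase : ∀ i, f (w i) = some i)
    (hfull : ∀ x, IsLink G w x → f x ≠ none) {Q : Finset (Fin m)} {r : Fin m → ℕ} {i j₀ : Fin m}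
    (hc : (missing G w f i).card ≤ (uncoloredNbrs G f (w i)).card)
    (hd : m ≤ dg G (w i) + 1)
    (hj : j₀ = i ∧ m ≤ dg G (w i) ∨ j₀ ≠ i ∧ ¬ Tied G w i j₀)
    (hy : ∀ y a, IsLoose G w y → f y = some a →
      (G.Adj (w i) y → ∃ j, j ≠ i ∧ j ≠ j₀ ∧ Near G w i j y) ∧
      (∀ x, G.Adj (w i) x → IsLoose G w x → f x = none → G.Adj x y → a ≠ i →
        Seen G w f i a ∨ ∃ j, j ≠ i ∧ j ≠ j₀ ∧ G.Adj y (w j)))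
    (hr : ∀ x y, IsLoose G w x → IsLoose G w y → f x = none → f y = none → G.Adj (w i) x →
      G.Adj x y → G.Adj y (w j₀) → j₀ ∈ Q → r j₀ < r i) :
    Processable G w f Q r i := by
  have hloose : ∀ x, f x = none → IsLoose G w x := fun x hx =>
    ⟨fun s hs => by rw [← hs, hbase] at hx; simp at hx, fun h => hfull x h hx⟩
  refine Or.inr ⟨hc, j₀, ?_, fun u hu hu0 => ?_, fun x y a hx hx0 hxy hya hai => ?_,
    fun x y hx hx0 hxy hy0 => hr x y (hloose x hx0) (hloose y hy0) hx0 hy0 hx hxy⟩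
  · rcases hj with h | h
    · exact Or.inl h.2
    · exact Or.inr ⟨h.1, hd⟩
  · by_cases h1 : ∀ s, w s ≠ u
    · by_cases h2 : IsLink G w u
      · by_cases h3 : ∃ s, s ≠ i ∧ s ≠ j₀ ∧ G.Adj u (w s)
        · obtain ⟨s, hs, hs', hus⟩ := h3
          exact ⟨s, hs, hs', hu, Or.inr (Or.inl hus)⟩
        · push Not at h3
          exfalso
          obtain ⟨s, hs, hus⟩ := h2.exists_ne i
          have hsj : s = j₀ := by
            by_contra h
            exact h3 s hs h hus
          subst hsj
          rcases hj with hj | hj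
          · exact hs hj.1
          · refine hj.2 (Or.inr ⟨u, h2, fun t => ⟨fun ht => ?_, ?_⟩⟩)
            · by_contra! h
              exact h3 t h.1 h.2 ht
            · rintro (rfl | rfl)
              · exact hu.symm
              · exact hus
      · obtain ⟨a, ha⟩ := Option.ne_none_iff_exists'.1 hu0
        exact (hy u a ⟨h1, h2⟩ ha).1 hu
    · push Not at h1
      obtain ⟨s, rfl⟩ := h1
      have hsi : s ≠ i := fun h => hu.ne (congrArg w h.symm)
      refine ⟨s, hsi, ?_, hu, Or.inl rfl⟩
      rintro rfl
      rcases hj with hj | hj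
      · exact hsi hj.1
      · exact hj.2 (Or.inl hu)
  · have hxl := hloose x hx0
    by_cases h1 : ∀ s, w s ≠ y
    · by_cases h2 : IsLink G w y
      · obtain ⟨s, hs, hys⟩ := h2.exists_ne j₀
        refine Or.inr ⟨s, ?_, hs, hys⟩
        rintro rfl
        exact hG.no3 hx hxy hys
      · exact (hy y a ⟨h1, h2⟩ hya).2 x hx hxl hx0 hxy hai
    · push Not at h1
      obtain ⟨s, rfl⟩ := h1
      rw [hbase, Option.some.injEq] at hya
      exact (hai (hya ▸ hxl.eq_of_adj hxy hx.symm)).elim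

theorem colored_of_saturated {g : V → Option (Fin m)} {i : Fin m}
    (hs : ∀ a, a ≠ i → Seen G w g i a) (hd : dg G (w i) < m) {u : V} (hu : G.Adj (w i) u) :
    g u ≠ none := by
  intro hu0
  have h1 : (missing G w g i).card = 0 := by
    rw [Finset.card_eq_zero, Finset.eq_empty_iff_forall_notMem]
    intro a ha
    exact (mem_missing.1 ha).2 (hs a (mem_missing.1 ha).1)
  have h2 := le_missing_add_card (G := G) (w := w) g i
  have h3 := card_coloredNbrs_add (G := G) g (w i)
  have h4 : 0 < (uncoloredNbrs G g (w i)).card :=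
    Finset.card_pos.2 ⟨u, mem_uncoloredNbrs.2 ⟨hu, hu0⟩⟩
  omega

open Classical in
/-- The indices that have to be processed. -/
noncomputable def procSet (G : SimpleGraph V) (w : Fin m → V) (v₀ : Fin m) : Finset (Fin m) :=
  Finset.univ.filter fun i => i ≠ v₀ ∨ m ≤ dg G (w v₀)

theorem mem_procSet {v₀ i : Fin m} : i ∈ procSet G w v₀ ↔ i ≠ v₀ ∨ m ≤ dg G (w v₀) := by
  classical
  simp [procSet]

/-- The conclusion of the construction: a proper coloring for which the members of `w` are
b-vertices, with the possible exception of `w v₀`. -/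
def HasCompletion (G : SimpleGraph V) (w : Fin m → V) (v₀ : Fin m) : Prop :=
  ∃ c : V → Fin m, IsProperColoring G c ∧ (∀ i, c (w i) = i) ∧
    ∀ i ∈ procSet G w v₀, IsBVertex G c (w i)

theorem HasCompletion.of_processable {f : V → Option (Fin m)} (hG : GirthSeven G)
    (hw : Function.Injective w) {v₀ : Fin m} (hbase : ∀ i, f (w i) = some i) (hf : PProper G f)
    (hfull : ∀ x, IsLink G w x → f x ≠ none)
    (hcov : ∀ u, m ≤ dg G u → (∃ i, w i = u) ∨ ∃ i, i ≠ v₀ ∧ dg G (w i) < m ∧ G.Adj (w i) u)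
    (r : Fin m → ℕ) (hQ : ∀ i ∈ procSet G w v₀, Processable G w f (procSet G w v₀) r i) :
    HasCompletion G w v₀ := by
  obtain ⟨g, hg, hgp, hsat⟩ := exists_saturation hG hw hbase hf hfull _ r hQ
  obtain ⟨c, hc, hcg⟩ := exists_extension_of_dg_lt g hgp (by
    intro u hu
    by_contra! h
    rcases hcov u h with ⟨i, rfl⟩ | ⟨i, hi, hd, hadj⟩
    · rw [hg _ _ (hbase i)] at hu
      simp at hu
    · exact colored_of_saturated (hsat i (mem_procSet.2 (Or.inl hi))) hd hadj hu)
  have hcw : ∀ i, c (w i) = i := fun i => hcg _ _ (hg _ _ (hbase i))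
  refine ⟨c, hc, hcw, fun i hi a ha => ?_⟩
  rw [hcw] at ha
  obtain ⟨u, hu, hua⟩ := hsat i hi a ha
  exact ⟨u, hu, hcg u a hua⟩

open Classical in
/-- The indices of vertices of degree less than `m` that are tied to `v₀` and that cannot be
processed before an index they are not connected to. -/
noncomputable def core (G : SimpleGraph V) (w : Fin m → V) (v₀ : Fin m) : Finset (Fin m) :=
  Finset.univ.filter fun i => i ≠ v₀ ∧ dg G (w i) < m ∧ Tied G w i v₀ ∧
    ∀ j, j ≠ i → Tied G w i j ∨ Threaded G w i j

theorem mem_core {v₀ i : Fin m} : i ∈ core G w v₀ ↔ i ≠ v₀ ∧ dg G (w i) < m ∧ Tied G w i v₀ ∧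
    ∀ j, j ≠ i → Tied G w i j ∨ Threaded G w i j := by
  classical
  simp [core]

theorem threaded_of_mem_core (hG : GirthSeven G) (hw : Function.Injective w) {v₀ i j : Fin m}
    (hi : i ∈ core G w v₀) (hj : j ∈ core G w v₀) (hij : i ≠ j) :
    ¬ Tied G w i j ∧ Threaded G w i j := by
  rw [mem_core] at hi hj
  have h := Tied.not_tied hG hw hij hi.1 hj.1 hi.2.2.1 hj.2.2.1
  exact ⟨h, (hi.2.2.2 j hij.symm).resolve_left h⟩

theorem Processable.of_notMem_core {f : V → Option (Fin m)} (hG : GirthSeven G)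
    (hbase : ∀ i, f (w i) = some i)
    (hfull : ∀ x, IsLink G w x → f x ≠ none) {r : Fin m → ℕ} {v₀ i : Fin m}
    (hi : i ∈ procSet G w v₀) (hic : i ∉ core G w v₀)
    (hc : (missing G w f i).card ≤ (uncoloredNbrs G f (w i)).card)
    (hd : m ≤ dg G (w i) + 1)
    (hy : ∀ y a, IsLoose G w y → f y = some a → ∃ c ∈ core G w v₀, G.Adj y (w c))
    (hr : i ≠ v₀ → r v₀ < r i) :
    Processable G w f (procSet G w v₀) r i := by
  have hy' : ∀ y a, IsLoose G w y → f y = some a → ¬ G.Adj (w i) y := by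
    intro y a hyl hya hiy
    obtain ⟨c, hcc, hyc⟩ := hy y a hyl hya
    exact hic (hyl.eq_of_adj hyc hiy.symm ▸ hcc)
  have hyc : ∀ (j₀ : Fin m), (j₀ ∈ core G w v₀ → ¬ Threaded G w i j₀) →
      ∀ y a, IsLoose G w y → f y = some a →
      (G.Adj (w i) y → ∃ j, j ≠ i ∧ j ≠ j₀ ∧ Near G w i j y) ∧
      (∀ x, G.Adj (w i) x → IsLoose G w x → f x = none → G.Adj x y → a ≠ i →
        Seen G w f i a ∨ ∃ j, j ≠ i ∧ j ≠ j₀ ∧ G.Adj y (w j)) := by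
    intro j₀ hj₀ y a hyl hya
    refine ⟨fun h => (hy' y a hyl hya h).elim, fun x hx hxl _ hxy _ => ?_⟩
    obtain ⟨c, hcc, hyc⟩ := hy y a hyl hya
    refine Or.inr ⟨c, fun e => hic (e ▸ hcc), ?_, hyc⟩
    rintro rfl
    exact hj₀ hcc ⟨x, y, hxl, hyl, hx, hxy, hyc⟩
  by_cases hdm : m ≤ dg G (w i)
  · refine Processable.of_index (j₀ := i) hG hbase hfull hc hd (Or.inl ⟨rfl, hdm⟩)
      (hyc i fun h => (hic h).elim) ?_
    intro x y _ _ _ _ hx hxy hy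
    exact (hG.no3 hx hxy hy).elim
  · have hiv : i ≠ v₀ := by
      rintro rfl
      exact ((mem_procSet.1 hi).resolve_left (fun h => h rfl)).not_gt (not_le.1 hdm)
    by_cases ht : Tied G w i v₀
    · obtain ⟨j, hj, hj1, hj2⟩ : ∃ j, j ≠ i ∧ ¬ Tied G w i j ∧ ¬ Threaded G w i j := by
        by_contra! h
        refine hic (mem_core.2 ⟨hiv, not_le.1 hdm, ht, fun j hj => ?_⟩)
        by_cases h' : Tied G w i j
        · exact Or.inl h'
        · exact Or.inr (h j hj h')
      refine Processable.of_index (j₀ := j) hG hbase hfull hc hd (Or.inr ⟨hj, hj1⟩)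
        (hyc j fun _ => hj2) ?_
      intro x y hxl hyl _ _ hx hxy hy
      exact (hj2 ⟨x, y, hxl, hyl, hx, hxy, hy⟩).elim
    · exact Processable.of_index (j₀ := v₀) hG hbase hfull hc hd (Or.inr ⟨hiv.symm, ht⟩)
        (hyc v₀ fun h => ((mem_core.1 h).1 rfl).elim) (fun x y _ _ _ _ _ _ _ _ => hr hiv)

theorem card_le_coloredNbrs {f : V → Option (Fin m)} (hw : Function.Injective w)
    (hbase : ∀ i, f (w i) = some i) (hfull : ∀ x, IsLink G w x → f x ≠ none) {i : Fin m}
    (D : Finset (Fin m)) (hi : i ∉ D) (hD : ∀ d ∈ D, Tied G w i d) :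
    D.card ≤ (coloredNbrs G f (w i)).card := by
  have h : ∀ d ∈ D, ∃ u, u ∈ coloredNbrs G f (w i) ∧
      (u = w d ∨ IsLink G w u ∧ ∀ s, G.Adj u (w s) ↔ s = i ∨ s = d) := by
    intro d hd
    rcases hD d hd with h | ⟨u, hu, hs⟩
    · exact ⟨w d, mem_coloredNbrs.2 ⟨h, by simp [hbase]⟩, Or.inl rfl⟩
    · exact ⟨u, mem_coloredNbrs.2 ⟨((hs i).2 (Or.inl rfl)).symm, hfull u hu⟩, Or.inr ⟨hu, hs⟩⟩
  have : Nonempty V := ⟨w i⟩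
  choose! u hu hu' using h
  refine Finset.card_le_card_of_injOn u hu (fun d hd d' hd' h => ?_)
  have h : u d = u d' := h
  rcases hu' d hd with h1 | ⟨h1, h1'⟩ <;> rcases hu' d' hd' with h2 | ⟨h2, h2'⟩
  · exact hw (h1.symm.trans (h.trans h2))
  · exact (h2.1 d (h1.symm.trans h)).elim
  · exact (h1.1 d' (h2.symm.trans h.symm)).elim
  · have h3 := (h1' d).2 (Or.inr rfl)
    rw [h, h2'] at h3
    rcases h3 with h3 | h3
    · exact (hi (h3 ▸ hd)).elim
    · exact h3

end Core

section Completion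

variable {V : Type} {G : SimpleGraph V} {m : ℕ} {w : Fin m → V}

open Classical in
theorem IsPrecoloring.update {v₀ : Fin m} {e : V} {f : V → Option (Fin m)}
    (hf : IsPrecoloring G w v₀ e f) {x : V} (hx : ∀ i, w i ≠ x) {a : Fin m}
    (ha : ∀ z, G.Adj x z → f z ≠ some a)
    (hr : ∀ i u, G.Adj (w i) x → G.Adj (w i) u → u ≠ x → f u ≠ some a) :
    IsPrecoloring G w v₀ e (Function.update f x (some a)) := by
  refine ⟨fun i => ?_, fun u v b huv hu hv => ?_, fun {i u u' b} he hu hu' hb hb' => ?_,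
    fun {u} hu => ?_⟩
  · rw [Function.update_of_ne (hx i), hf.base]
  · by_cases hux : u = x
    · subst hux
      rw [Function.update_self, Option.some.injEq] at hu
      rw [Function.update_of_ne huv.ne'] at hv
      exact ha v huv (hu ▸ hv)
    · rw [Function.update_of_ne hux] at hu
      by_cases hvx : v = x
      · subst hvx
        rw [Function.update_self, Option.some.injEq] at hv
        exact ha u huv.symm (hv ▸ hu)
      · rw [Function.update_of_ne hvx] at hv
        exact hf.proper u v b huv hu hv
  · by_cases hux : u = x
    · by_cases hvx : u' = x
      · rw [hux, hvx]
      · subst hux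
        rw [Function.update_self, Option.some.injEq] at hb
        rw [Function.update_of_ne hvx] at hb'
        exact (hr i u' hu hu' hvx (hb ▸ hb')).elim
    · rw [Function.update_of_ne hux] at hb
      by_cases hvx : u' = x
      · subst hvx
        rw [Function.update_self, Option.some.injEq] at hb'
        exact (hr i u hu' hu hux (hb' ▸ hb)).elim
      · rw [Function.update_of_ne hvx] at hb'
        exact hf.rainbow he hu hu' hb hb'
  · by_cases hux : u = x
    · simp [hux]
    · rw [Function.update_of_ne hux]
      exact hf.full hu

variable [Fintype V]

open Classical in
theorem HasCompletion.of_missing_ne (hG : GirthSeven G) (hw : Function.Injective w)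
    (hd : ∀ i, m ≤ dg G (w i) + 1) {v₀ : Fin m} {e : V} {f : V → Option (Fin m)}
    (hf : IsPrecoloring G w v₀ e f) (hdom : ∀ u a, f u = some a → ¬ IsLoose G w u)
    (hcov : ∀ u, m ≤ dg G u → (∃ i, w i = u) ∨ ∃ i, i ≠ v₀ ∧ dg G (w i) < m ∧ G.Adj (w i) u)
    (hT : ∀ c ∈ core G w v₀, ∀ d, d ∉ core G w v₀ → ¬ Threaded G w c d)
    {c c' j : Fin m} (hc : c ∈ core G w v₀) (hc' : c' ∈ core G w v₀)
    (hj' : j ∈ missing G w f c') (hj : j ∉ missing G w f c) : HasCompletion G w v₀ := by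
  have hcc : c ≠ c' := by rintro rfl; exact hj hj'
  obtain ⟨x, y, hxl, hyl, hcx, hxy, hyc'⟩ := (threaded_of_mem_core hG hw hc hc' hcc).2
  have hN : ∀ z, G.Adj y z → f z ≠ some j := by
    intro z hyz hz
    have hzl := hdom z j hz
    by_cases h1 : ∀ s, w s ≠ z
    · have h2 : IsLink G w z := by
        by_contra h
        exact hzl ⟨h1, h⟩
      obtain ⟨s, hs, hzs⟩ := h2.exists_ne c'
      have hnear : Near G w c' s y :=
        ⟨hyc'.symm, Or.inr (Or.inr ⟨z, (h1 c').symm, hyz, hzs⟩)⟩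
      have hne : w c' ≠ w s := fun h => hs (hw h).symm
      by_cases hsc : s ∈ core G w v₀
      · obtain ⟨x', y', hx', hy', h3, h4, h5⟩ := (threaded_of_mem_core hG hw hc' hsc hs.symm).2
        have h6 : y = x' := hnear.unique hG hne
          ⟨h3, Or.inr (Or.inr ⟨y', (hy'.1 c').symm, h4, h5⟩)⟩
        subst h6
        have h7 := hG.mid_unique hyz hzs h4 h5 (hyl.1 s).symm
        exact hy'.2 (h7 ▸ h2)
      · obtain ⟨u, hu, hu'⟩ :=
          (((mem_core.1 hc').2.2.2 s hs).resolve_right (hT c' hc' s hsc)).near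
        exact hu (hu'.unique hG hne hnear ▸ hyl)
    · push Not at h1
      obtain ⟨s, rfl⟩ := h1
      have h2 := hyl.eq_of_adj hyz hyc'
      rw [hf.base, Option.some.injEq] at hz
      exact (mem_missing.1 hj').1 (hz.symm.trans h2)
  have hyi : ∀ {i}, G.Adj (w i) y → i = c' := fun h => hyl.eq_of_adj h.symm hyc'
  set g := Function.update f y (some j) with hg
  have hfg : IsPrecoloring G w v₀ e g := by
    refine hf.update hyl.1 hN (fun i u hiy hiu _ hu => ?_)
    rw [hyi hiy] at hiu
    exact (mem_missing.1 hj').2 ⟨u, hiu, hu⟩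
  have hfext : ∀ u a, f u = some a → g u = some a := by
    intro u a hu
    rw [hg, Function.update_of_ne, hu]
    rintro rfl
    exact hdom u a hu hyl
  have hgy : g y = some j := Function.update_self ..
  have hgdom : ∀ u a, IsLoose G w u → g u = some a → u = y ∧ a = j := by
    intro u a hul hu
    by_cases huy : u = y
    · rw [huy, hgy, Option.some.injEq] at hu
      exact ⟨huy, hu.symm⟩
    · rw [hg, Function.update_of_ne huy] at hu
      exact (hdom u a hu hul).elim
  refine HasCompletion.of_processable hG hw hfg.base hfg.proper (fun u hu => hfg.full hu) hcov
    (fun i => if i = v₀ then 0 else if i ∉ core G w v₀ then 1 else if i = c then 2 else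
      if i = c' then 4 else 3) (fun i hi => ?_)
  have hmis := hfg.missing_le (hd i) (mem_procSet.1 hi)
  by_cases hic : i ∈ core G w v₀
  swap
  · refine Processable.of_notMem_core hG hfg.base (fun u hu => hfg.full hu) hi hic hmis (hd i)
      (fun z a hz hza => ?_) (fun h => by simp [h, hic])
    exact ⟨c', hc', (hgdom z a hz hza).1 ▸ hyc'⟩
  have hv : ∀ {i}, i ∈ core G w v₀ → i ≠ v₀ := fun h => (mem_core.1 h).1
  by_cases h1 : i = c
  · subst h1
    refine Processable.of_index (j₀ := c') hG hfg.base (fun u hu => hfg.full hu) hmis (hd i)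
      (Or.inr ⟨hcc.symm, (threaded_of_mem_core hG hw hc hc' hcc).1⟩) (fun z a hz hza => ?_) ?_
    · obtain ⟨rfl, rfl⟩ := hgdom z a hz hza
      refine ⟨fun h => (hcc (hyi h)).elim, fun x' _ _ _ _ hai => Or.inl ?_⟩
      by_contra h
      refine hj (mem_missing.2 ⟨hai, fun ⟨u, hu, hua⟩ => h ⟨u, hu, hfext u _ hua⟩⟩)
    · intro x' y' hx' hy' _ hy'0 h2 h3 h4 _
      exfalso
      have h5 : x' = x := Near.unique hG (fun h => hcc (hw h))
        ⟨h2, Or.inr (Or.inr ⟨y', (hy'.1 i).symm, h3, h4⟩)⟩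
        ⟨hcx, Or.inr (Or.inr ⟨y, (hyl.1 i).symm, hxy, hyc'⟩)⟩
      subst h5
      have h6 := hG.mid_unique h3 h4 hxy hyc' (hx'.1 c').symm
      rw [h6, hgy] at hy'0
      simp at hy'0
  by_cases h2 : i = c'
  · subst h2
    by_cases h3 : ∃ b ∈ core G w v₀, b ≠ c ∧ b ≠ i
    · obtain ⟨b, hb, hbc, hbi⟩ := h3
      refine Processable.of_index (j₀ := b) hG hfg.base (fun u hu => hfg.full hu) hmis (hd i)
        (Or.inr ⟨hbi, (threaded_of_mem_core hG hw hc' hb hbi.symm).1⟩) (fun z a hz hza => ?_) ?_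
      · obtain ⟨rfl, rfl⟩ := hgdom z a hz hza
        refine ⟨fun h => ⟨c, hcc, hbc.symm, h,
          Or.inr (Or.inr ⟨x, (hxl.1 i).symm, hxy.symm, hcx.symm⟩)⟩, fun x' h4 _ _ h5 _ => ?_⟩
        exact (hG.no3 h4 h5 hyc').elim
      · intro x' y' _ _ _ _ _ _ _ _
        simp [hv hb, hv hc', hb, hc', hbc, hbi, h1]
    · push Not at h3
      left
      have hD := card_le_coloredNbrs hw hf.base (fun u hu => hf.full hu)
        (i := i) ((Finset.univ.erase i).erase c) (by simp) (fun d hd => by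
          simp only [Finset.mem_erase, Finset.mem_univ, and_true] at hd
          have hdc : d ∉ core G w v₀ := fun h => hd.2 (h3 d h hd.1)
          exact ((mem_core.1 hc').2.2.2 d hd.2).resolve_right (hT i hc' d hdc))
      rw [Finset.card_erase_of_mem (by simp [hcc]), Finset.card_erase_of_mem (Finset.mem_univ i),
        Finset.card_univ, Fintype.card_fin] at hD
      have hy0 : y ∉ coloredNbrs G f (w i) := fun h => by
        obtain ⟨a, ha⟩ := Option.ne_none_iff_exists'.1 (mem_coloredNbrs.1 h).2
        exact hdom y a ha hyl
      have hle := missing_add_card_le hfg.base hfg.proper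
        (insert y (coloredNbrs G f (w i))) (i := i) (by
          intro u hu
          rcases Finset.mem_insert.1 hu with rfl | hu
          · exact mem_coloredNbrs.2 ⟨hyc'.symm, by simp [hgy]⟩
          · obtain ⟨hu1, hu2⟩ := mem_coloredNbrs.1 hu
            obtain ⟨a, ha⟩ := Option.ne_none_iff_exists'.1 hu2
            exact mem_coloredNbrs.2 ⟨hu1, by simp [hfext u a ha]⟩)
        (by
          have hadj : ∀ u ∈ insert y (coloredNbrs G f (w i)), G.Adj (w i) u := by
            intro u hu
            rcases Finset.mem_insert.1 hu with rfl | hu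
            · exact hyc'.symm
            · exact (mem_coloredNbrs.1 hu).1
          intro u hu u' hu' a ha ha'
          exact hfg.rainbow (fun h => (hv hc' h).elim) (hadj u hu) (hadj u' hu') ha ha')
      rw [Finset.card_insert_of_notMem hy0] at hle
      have h0 : (missing G w g i).card = 0 := by omega
      intro a hai
      by_contra h
      rw [Finset.card_eq_zero, Finset.eq_empty_iff_forall_notMem] at h0
      exact h0 a (mem_missing.2 ⟨hai, h⟩)
  · refine Processable.of_index (j₀ := c) hG hfg.base (fun u hu => hfg.full hu) hmis (hd i)
      (Or.inr ⟨fun h => h1 h.symm, (threaded_of_mem_core hG hw hic hc h1).1⟩)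
      (fun z a hz hza => ?_) ?_
    · obtain ⟨rfl, rfl⟩ := hgdom z a hz hza
      exact ⟨fun h => (h2 (hyi h)).elim, fun _ _ _ _ _ _ =>
        Or.inr ⟨c', fun h => h2 h.symm, hcc.symm, hyc'⟩⟩
    · intro x' y' _ _ _ _ _ _ _ _
      simp [hv hc, hv hic, hc, hic, h1, h2]

open Classical in
theorem HasCompletion.of_core_pair (hG : GirthSeven G) (hw : Function.Injective w)
    (hd : ∀ i, m ≤ dg G (w i) + 1) {v₀ : Fin m} {e : V} {f : V → Option (Fin m)}
    (hf : IsPrecoloring G w v₀ e f) (hdom : ∀ u a, f u = some a → ¬ IsLoose G w u)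
    (hcov : ∀ u, m ≤ dg G u → (∃ i, w i = u) ∨ ∃ i, i ≠ v₀ ∧ dg G (w i) < m ∧ G.Adj (w i) u)
    (hex : 4 ≤ m ∨ (∀ x y, IsLink G w x → IsLink G w y → G.Adj x (w v₀) → G.Adj y (w v₀) →
      x = y) ∨ ∃ i, i ≠ v₀ ∧ m ≤ dg G (w i))
    (hT : ∀ c ∈ core G w v₀, ∀ d, d ∉ core G w v₀ → ¬ Threaded G w c d)
    {c c' : Fin m} (hc : c ∈ core G w v₀) (hc' : c' ∈ core G w v₀) (hcc : c ≠ c') :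
    HasCompletion G w v₀ := by
  by_cases hconst : ∀ b ∈ core G w v₀, ∀ b' ∈ core G w v₀, missing G w f b' ⊆ missing G w f b
  swap
  · push Not at hconst
    obtain ⟨b, hb, b', hb', hbb⟩ := hconst
    obtain ⟨j, hj', hj⟩ := Finset.not_subset.1 hbb
    exact HasCompletion.of_missing_ne hG hw hd hf hdom hcov hT hb hb' hj' hj
  have hne : ∀ {b d}, b ∈ core G w v₀ → d ∉ core G w v₀ → b ≠ d := by
    rintro b d hb hd rfl
    exact hd hb
  have htied : ∀ {b d}, b ∈ core G w v₀ → d ∉ core G w v₀ → Tied G w b d := fun {b d} hb hd =>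
    ((mem_core.1 hb).2.2.2 d (hne hb hd).symm).resolve_right (hT b hb d hd)
  have hlink : ∀ {b d}, b ∈ core G w v₀ → d ∉ core G w v₀ →
      ∃ u, IsLink G w u ∧ ∀ s, G.Adj u (w s) ↔ s = b ∨ s = d := by
    intro b d hb hd
    refine (htied hb hd).resolve_left fun hadj => ?_
    obtain ⟨b', hb', hbb⟩ : ∃ b' ∈ core G w v₀, b' ≠ b := by
      by_cases h : c = b
      · exact ⟨c', hc', h ▸ hcc.symm⟩
      · exact ⟨c, hc, h⟩
    obtain ⟨x, hx, hx'⟩ := (threaded_of_mem_core hG hw hb' hb hbb).2.near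
    have hne' : w b' ≠ w b := fun h => hbb (hw h)
    rcases htied hb' hd with h | ⟨u, hu, hs⟩
    · exact hx.1 d (hx'.unique hG hne' ⟨h, Or.inr (Or.inl hadj.symm)⟩).symm
    · refine hx.2 (hx'.unique hG hne' ⟨((hs b').2 (Or.inl rfl)).symm, Or.inr (Or.inr ⟨w d, ?_,
        (hs d).2 (Or.inr rfl), hadj.symm⟩)⟩ ▸ hu)
      exact fun h => hne hb' hd (hw h).symm
  have hcoreNear : ∀ {b s u}, b ∈ core G w v₀ → s ∈ core G w v₀ → b ≠ s → ¬ IsLoose G w u →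
      ¬ Near G w b s u := by
    intro b s u hb hs hbs hu h
    obtain ⟨x, hx, hx'⟩ := (threaded_of_mem_core hG hw hb hs hbs).2.near
    exact hu (h.unique hG (fun h => hbs (hw h)) hx' ▸ hx)
  have hmis : ∀ j ∈ missing G w f c, j ∉ core G w v₀ := fun j hj hjc =>
    (mem_missing.1 (hconst j hjc c hc hj)).1 rfl
  have hcard : (core G w v₀).card ≤ (missing G w f c).card + 1 := by
    have h1 : ∀ u ∈ coloredNbrs G f (w c), ∃ d, d ∉ core G w v₀ ∧ Near G w c d u := by
      intro u hu
      obtain ⟨hcu, hu0⟩ := mem_coloredNbrs.1 hu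
      obtain ⟨a, ha⟩ := Option.ne_none_iff_exists'.1 hu0
      have hul := hdom u a ha
      have : ∃ d, d ≠ c ∧ Near G w c d u := by
        by_cases h1 : ∀ s, w s ≠ u
        · have h2 : IsLink G w u := by
            by_contra h
            exact hul ⟨h1, h⟩
          obtain ⟨s, hs, hus⟩ := h2.exists_ne c
          exact ⟨s, hs, hcu, Or.inr (Or.inl hus)⟩
        · push Not at h1
          obtain ⟨s, rfl⟩ := h1
          exact ⟨s, fun h => hcu.ne (congrArg w h.symm), hcu, Or.inl rfl⟩
      obtain ⟨d, hdc, hnear⟩ := this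
      exact ⟨d, fun h => hcoreNear hc h hdc.symm hul hnear, hnear⟩
    have : Nonempty (Fin m) := ⟨c⟩
    choose! d hdc hdn using h1
    have h2 := Finset.card_le_card_of_injOn (t := Finset.univ \ core G w v₀) d
      (fun u hu => by simpa using hdc u hu) (fun u hu u' hu' h => by
        have h3 := hdn u hu
        rw [show d u = d u' from h] at h3
        exact h3.unique hG (fun h => hne hc (hdc u' hu') (hw h)) (hdn u' hu'))
    rw [Finset.card_sdiff_of_subset (Finset.subset_univ _), Finset.card_univ,
      Fintype.card_fin] at h2
    have h3 := le_missing_add_card (G := G) (w := w) f c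
    have h4 : (core G w v₀).card ≤ m := by simpa using Finset.card_le_univ (core G w v₀)
    omega
  have hcore2 : 1 < (core G w v₀).card := Finset.one_lt_card.2 ⟨c, hc, c', hc', hcc⟩
  obtain ⟨j, hj⟩ : (missing G w f c).Nonempty := by
    rw [← Finset.card_pos]; omega
  have hjc := hmis j hj
  have hv₀ : v₀ ∉ core G w v₀ := fun h => (mem_core.1 h).1 rfl
  by_cases hD : ∃ d, d ∉ core G w v₀ ∧ d ≠ j
  swap
  · push Not at hD
    exfalso
    obtain rfl := hD v₀ hv₀
    rcases hex with h4 | h1 | ⟨i, hi, hi'⟩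
    · have h5 : missing G w f c ⊆ {v₀} := fun a ha =>
        Finset.mem_singleton.2 (hD a (hmis a ha))
      have h6 := Finset.card_le_card h5
      have h7 : Finset.univ \ core G w v₀ ⊆ {v₀} := fun a ha => by
        simp only [Finset.mem_sdiff, Finset.mem_univ, true_and] at ha
        exact Finset.mem_singleton.2 (hD a ha)
      have h8 := Finset.card_le_card h7
      rw [Finset.card_sdiff_of_subset (Finset.subset_univ _), Finset.card_univ,
        Fintype.card_fin] at h8
      rw [Finset.card_singleton] at h6 h8
      omega
    · obtain ⟨u, hu, hs⟩ := hlink hc hv₀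
      obtain ⟨u', hu', hs'⟩ := hlink hc' hv₀
      have h2 := h1 u u' hu hu' ((hs v₀).2 (Or.inr rfl)) ((hs' v₀).2 (Or.inr rfl))
      subst h2
      exact ((hs c').1 ((hs' c').2 (Or.inl rfl))).elim hcc.symm (hne hc' hv₀)
    · exact hi (hD i fun h => (mem_core.1 h).2.1.not_ge hi')
  obtain ⟨d, hdc, hdj⟩ := hD
  obtain ⟨l, hl, hls⟩ := hlink hc hdc
  have hlc := (hls c).2 (Or.inl rfl)
  have hld := (hls d).2 (Or.inr rfl)
  have hwcd : w c ≠ w d := fun h => hne hc hdc (hw h)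
  have hN : ∀ z, G.Adj l z → f z ≠ some j := by
    intro z hlz hz
    have hzl := hdom z j hz
    by_cases h1 : ∀ s, w s ≠ z
    · have h2 : IsLink G w z := by
        by_contra h
        exact hzl ⟨h1, h⟩
      obtain ⟨s, hs, hzs⟩ := h2.exists_ne c
      have hnear : Near G w c s l := ⟨hlc.symm, Or.inr (Or.inr ⟨z, (h1 c).symm, hlz, hzs⟩)⟩
      by_cases hsc : s ∈ core G w v₀
      · exact hcoreNear hc hsc hs.symm (fun h => h.2 hl) hnear
      · obtain ⟨u, hu, hus⟩ := hlink hc hsc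
        have hlu : l = u := hnear.unique hG (fun h => hs (hw h).symm)
          ⟨((hus c).2 (Or.inl rfl)).symm, Or.inr (Or.inl ((hus s).2 (Or.inr rfl)))⟩
        exact hG.no3 hlz hzs (hlu ▸ ((hus s).2 (Or.inr rfl)).symm)
    · push Not at h1
      obtain ⟨s, rfl⟩ := h1
      rw [hf.base, Option.some.injEq] at hz
      subst hz
      exact ((hls s).1 hlz).elim (hne hc hjc).symm hdj.symm
  have hR : ∀ i u, G.Adj (w i) l → G.Adj (w i) u → u ≠ l → f u ≠ some j := by
    intro i u hil hiu hul hu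
    rcases (hls i).1 hil.symm with rfl | rfl
    · exact (mem_missing.1 hj).2 ⟨u, hiu, hu⟩
    · have hu' := hdom u j hu
      by_cases h1 : ∀ s, w s ≠ u
      · have h2 : IsLink G w u := by
          by_contra h
          exact hu' ⟨h1, h⟩
        obtain ⟨s, hs, hus⟩ := h2.exists_ne i
        by_cases hsc : s ∈ core G w v₀
        · exact (mem_missing.1 (hconst s hsc c hc hj)).2 ⟨u, hus.symm, hu⟩
        · obtain ⟨v, hv, hvs⟩ := hlink hc hsc
          refine hG.no6 hlc.symm hld hiu hus ((hvs s).2 (Or.inr rfl)).symm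
            ((hvs c).2 (Or.inl rfl)) hwcd hul.symm (fun h => hs (hw h).symm) ?_
            (fun h => hne hc hsc (hw h).symm) ?_
          · rintro rfl
            exact ((hvs i).1 hiu.symm).elim (hne hc hdc).symm hs.symm
          · rintro rfl
            exact ((hls s).1 ((hvs s).2 (Or.inr rfl))).elim (hne hc hsc).symm hs
      · push Not at h1
        obtain ⟨s, rfl⟩ := h1
        rw [hf.base, Option.some.injEq] at hu
        subst hu
        obtain ⟨v, hv, hvs⟩ := hlink hc hjc
        have hlv : l = v := Near.unique hG hwcd ⟨hlc.symm, Or.inr (Or.inl hld)⟩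
          ⟨((hvs c).2 (Or.inl rfl)).symm, Or.inr (Or.inr ⟨w s, fun h => hne hc hjc (hw h).symm,
            (hvs s).2 (Or.inr rfl), hiu.symm⟩)⟩
        subst hlv
        exact ((hls s).1 ((hvs s).2 (Or.inr rfl))).elim (hne hc hjc).symm hdj.symm
  refine HasCompletion.of_missing_ne hG hw hd (hf.update hl.1 hN hR) (fun u a hu hul => ?_) hcov
    hT hc hc' (j := j) ?_ ?_
  · have hne' : u ≠ l := by rintro rfl; exact hul.2 hl
    rw [Function.update_of_ne hne'] at hu
    exact hdom u a hu hul
  · refine mem_missing.2 ⟨(hne hc' hjc).symm, fun ⟨u, hu, hua⟩ => ?_⟩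
    by_cases hul : u = l
    · subst hul
      exact ((hls c').1 hu.symm).elim hcc.symm (hne hc' hdc)
    · rw [Function.update_of_ne hul] at hua
      exact (mem_missing.1 (hconst c' hc' c hc hj)).2 ⟨u, hu, hua⟩
  · intro h
    exact (mem_missing.1 h).2 ⟨l, hlc.symm, Function.update_self ..⟩

open Classical in
theorem HasCompletion.of_precoloring (hG : GirthSeven G) (hw : Function.Injective w)
    (hd : ∀ i, m ≤ dg G (w i) + 1) {v₀ : Fin m} {e : V} {f : V → Option (Fin m)}
    (hf : IsPrecoloring G w v₀ e f) (hdom : ∀ u a, f u = some a → ¬ IsLoose G w u)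
    (hcov : ∀ u, m ≤ dg G u → (∃ i, w i = u) ∨ ∃ i, i ≠ v₀ ∧ dg G (w i) < m ∧ G.Adj (w i) u)
    (hex : 4 ≤ m ∨ (∀ x y, IsLink G w x → IsLink G w y → G.Adj x (w v₀) → G.Adj y (w v₀) →
      x = y) ∨ ∃ i, i ≠ v₀ ∧ m ≤ dg G (w i)) :
    HasCompletion G w v₀ := by
  have hv : ∀ {i}, i ∈ core G w v₀ → i ≠ v₀ := fun h => (mem_core.1 h).1
  by_cases h1 : ∃ c ∈ core G w v₀, ∃ d, d ∉ core G w v₀ ∧ Threaded G w c d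
  · refine HasCompletion.of_processable hG hw hf.base hf.proper (fun u hu => hf.full hu) hcov
      (fun i => if i = v₀ then 0 else if i ∉ core G w v₀ then 1 else
        if ∃ d, d ∉ core G w v₀ ∧ Threaded G w i d then 2 else 3) (fun i hi => ?_)
    have hmis := hf.missing_le (hd i) (mem_procSet.1 hi)
    by_cases hic : i ∈ core G w v₀
    swap
    · exact Processable.of_notMem_core hG hf.base (fun u hu => hf.full hu) hi hic hmis (hd i)
        (fun z a hz hza => (hdom z a hza hz).elim) (fun h => by simp [h, hic])
    have hloose : ∀ (j : Fin m) y a, IsLoose G w y → f y = some a →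
        (G.Adj (w i) y → ∃ j', j' ≠ i ∧ j' ≠ j ∧ Near G w i j' y) ∧
        (∀ x, G.Adj (w i) x → IsLoose G w x → f x = none → G.Adj x y → a ≠ i →
          Seen G w f i a ∨ ∃ j', j' ≠ i ∧ j' ≠ j ∧ G.Adj y (w j')) :=
      fun j y a hy hya => (hdom y a hya hy).elim
    by_cases h2 : ∃ d, d ∉ core G w v₀ ∧ Threaded G w i d
    · obtain ⟨d, hdc, hid⟩ := id h2
      have hne : i ≠ d := by rintro rfl; exact hdc hic
      refine Processable.of_index (j₀ := d) hG hf.base (fun u hu => hf.full hu) hmis (hd i)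
        (Or.inr ⟨hne.symm, fun h => h.not_threaded hG hw hne hid⟩) (hloose d) ?_
      intro x' y' _ _ _ _ _ _ _ _
      by_cases hdv : d = v₀
      · simp [hdv, hv hic, hic, h2]
      · simp [hdv, hv hic, hic, hdc, h2]
    · obtain ⟨c, hc, hc'⟩ := h1
      have hne : i ≠ c := by rintro rfl; exact h2 hc'
      refine Processable.of_index (j₀ := c) hG hf.base (fun u hu => hf.full hu) hmis (hd i)
        (Or.inr ⟨hne.symm, (threaded_of_mem_core hG hw hic hc hne).1⟩) (hloose c) ?_
      intro x' y' _ _ _ _ _ _ _ _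
      simp [hv hc, hv hic, hic, hc, h2, hc']
  · push Not at h1
    by_cases h2 : ∃ c ∈ core G w v₀, ∃ c' ∈ core G w v₀, c ≠ c'
    · obtain ⟨c, hc, c', hc', hcc⟩ := h2
      exact HasCompletion.of_core_pair hG hw hd hf hdom hcov hex h1 hc hc' hcc
    · push Not at h2
      refine HasCompletion.of_processable hG hw hf.base hf.proper (fun u hu => hf.full hu) hcov
        (fun i => if i = v₀ then 0 else 1) (fun i hi => ?_)
      have hmis := hf.missing_le (hd i) (mem_procSet.1 hi)
      by_cases hic : i ∈ core G w v₀
      swap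
      · exact Processable.of_notMem_core hG hf.base (fun u hu => hf.full hu) hi hic hmis (hd i)
          (fun z a hz hza => (hdom z a hza hz).elim) (fun h => by simp [h])
      left
      have hD := card_le_coloredNbrs hw hf.base (fun u hu => hf.full hu)
        (i := i) (Finset.univ.erase i) (by simp) (fun d hd => by
          simp only [Finset.mem_erase, Finset.mem_univ, and_true] at hd
          have hdc : d ∉ core G w v₀ := fun h => hd (h2 d h i hic)
          exact ((mem_core.1 hic).2.2.2 d hd).resolve_right (h1 i hic d hdc))
      rw [Finset.card_erase_of_mem (Finset.mem_univ i), Finset.card_univ, Fintype.card_fin] at hD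
      have hle := missing_add_card_le hf.base hf.proper (coloredNbrs G f (w i)) subset_rfl
        (fun u hu u' hu' a ha ha' => hf.rainbow (fun h => (hv hic h).elim)
          (mem_coloredNbrs.1 hu).1 (mem_coloredNbrs.1 hu').1 ha ha')
      have h0 : (missing G w f i).card = 0 := by omega
      intro a hai
      by_contra h
      rw [Finset.card_eq_zero, Finset.eq_empty_iff_forall_notMem] at h0
      exact h0 a (mem_missing.2 ⟨hai, h⟩)

end Completion

section Cases

variable {V : Type} {G : SimpleGraph V} {m : ℕ} {w : Fin m → V}

/-- A vertex encircling `w` is the only link. -/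
theorem Encircles.eq_of_isLink (hG : GirthSeven G) (hw : Function.Injective w) {x y : V}
    (hx : ∀ i, w i ≠ x) (h : Encircles G w x) (hy : IsLink G w y) : y = x := by
  obtain ⟨hyw, a, b, hab, ha, hb⟩ := hy
  by_contra hne
  have wab : w a ≠ w b := fun e => hab (hw e)
  rcases h a with h1 | ⟨s, h1, h1'⟩ <;> rcases h b with h2 | ⟨t, h2, h2'⟩
  · exact hG.no4 h1 ha.symm hb h2.symm (Ne.symm hne) wab
  · exact hG.no5 h1 ha.symm hb h2'.symm h2.symm
  · exact hG.no5 h2 hb.symm ha h1'.symm h1.symm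
  · by_cases hst : w s = w t
    · rw [← hst] at h2'
      exact hG.no4 h1' ha.symm hb h2'.symm (hyw s) wab
    · exact hG.no6 h1 h1' ha.symm hb h2'.symm h2.symm (hx a).symm (hyw s) wab (hyw t).symm
        (hx b) (Ne.symm hst)

theorem HasCompletion.of_not_encircles [Fintype V] (hG : GirthSeven G)
    (hw : Function.Injective w) (hd : ∀ i, m ≤ dg G (w i) + 1)
    (hW : ∀ x, IsLink G w x → ¬ Encircles G w x) {v₀ : Fin m}
    (hcov : ∀ u, m ≤ dg G u → (∃ i, w i = u) ∨ ∃ i, i ≠ v₀ ∧ dg G (w i) < m ∧ G.Adj (w i) u)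
    (hex : 4 ≤ m ∨ (∀ x y, IsLink G w x → IsLink G w y → G.Adj x (w v₀) → G.Adj y (w v₀) →
      x = y) ∨ ∃ i, i ≠ v₀ ∧ m ≤ dg G (w i)) : HasCompletion G w v₀ := by
  obtain ⟨f, hf, hfull⟩ := exists_isLinkColoring hG hw hW
  refine .of_precoloring hG hw hd (e := w v₀) ⟨hf.base, hf.proper, fun _ => hf.rainbow, hfull _⟩
    (fun u a hu hl => ?_) hcov hex
  rcases hf.dom hu with ⟨i, hi⟩ | h
  · exact hl.1 i hi
  · exact hl.2 h

theorem HasCompletion.of_encircles [Fintype V] (hG : GirthSeven G)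
    (hw : Function.Injective w) (hd : ∀ i, m ≤ dg G (w i) + 1) {x : V} (hx : IsLink G w x)
    (hW : Encircles G w x) {v c : Fin m} (hv : G.Adj x (w v)) (hc : G.Adj (w v) (w c))
    (hM : ∀ u, m ≤ dg G u → ∃ i, w i = u) : HasCompletion G w v := by
  classical
  obtain ⟨f, hf, hf0⟩ := exists_isLinkColoring_base (G := G) hw
  have huniq : ∀ y, IsLink G w y → y = x := fun y hy => hW.eq_of_isLink hG hw hx.1 hy
  have hval : ∀ {u a}, Function.update f x (some c) u = some a →
      (u = x ∧ a = c) ∨ (u ≠ x ∧ u = w a) := by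
    intro u a hu
    by_cases hux : u = x
    · subst hux
      simp only [Function.update_self, Option.some.injEq] at hu
      exact Or.inl ⟨rfl, hu.symm⟩
    · rw [Function.update_of_ne hux] at hu
      by_cases hi : ∃ i, w i = u
      · obtain ⟨i, rfl⟩ := hi
        rw [hf.base, Option.some.injEq] at hu
        exact Or.inr ⟨hux, by rw [hu]⟩
      · rw [hf0 u (fun i hi' => hi ⟨i, hi'⟩)] at hu
        exact absurd hu (by simp)
  refine .of_precoloring hG hw hd (e := x) (f := Function.update f x (some c))
    ⟨fun i => ?_, fun u u' a huu hu hu' => ?_, fun {i u u' a} hi h h' hu hu' => ?_, fun {u} hu => ?_⟩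
    (fun u a hu hl => ?_) (fun u hu => Or.inl (hM u hu))
    (Or.inr (Or.inl fun y y' hy hy' _ _ => (huniq y hy).trans (huniq y' hy').symm))
  · rw [Function.update_of_ne (hx.1 i), hf.base]
  · rcases hval hu with ⟨rfl, rfl⟩ | ⟨hux, rfl⟩ <;> rcases hval hu' with ⟨rfl, h⟩ | ⟨hux', rfl⟩
    · exact huu.ne rfl
    · exact hG.no3 hv hc huu.symm
    · subst h
      exact hG.no3 hv hc huu
    · exact huu.ne rfl
  · rcases hval hu with ⟨rfl, rfl⟩ | ⟨hux, rfl⟩ <;> rcases hval hu' with ⟨rfl, e⟩ | ⟨hux', rfl⟩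
    · rfl
    · exact absurd rfl (hi (hw (hG.mid_unique h.symm h' hv hc (hx.1 _).symm))).1
    · subst e
      exact absurd rfl (hi (hw (hG.mid_unique h'.symm h hv hc (hx.1 _).symm))).2
    · rfl
  · rw [huniq u hu]
    simp
  · rcases hval hu with ⟨rfl, rfl⟩ | ⟨-, rfl⟩
    · exact hl.2 hx
    · exact hl.1 _ rfl

theorem HasCompletion.exists_hasBColoring [Fintype V] {v₀ : Fin m} (h : HasCompletion G w v₀) :
    ∃ l, m ≤ l + 1 ∧ (m ≤ dg G (w v₀) → m ≤ l) ∧ HasBColoring G l := by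
  classical
  obtain ⟨c, hc, hcw, hb⟩ := h
  obtain ⟨l, hl, hl'⟩ := exists_hasBColoring_of_bVertices c hc (procSet G w v₀)
    (fun i hi => ⟨w i, hcw i, hb i hi⟩)
  refine ⟨l, ?_, fun h => ?_, hl'⟩
  · have : Finset.univ.erase v₀ ⊆ procSet G w v₀ := fun i hi =>
      mem_procSet.2 (Or.inl (Finset.ne_of_mem_erase hi))
    have := Finset.card_le_card this
    rw [Finset.card_erase_of_mem (Finset.mem_univ _), Finset.card_fin] at this
    omega
  · have : procSet G w v₀ = Finset.univ := by
      ext i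
      simp [mem_procSet, h]
    rw [this, Finset.card_fin] at hl
    exact hl

/-- A vertex of small degree encircling `w` has a neighbour in `w` with a further neighbour
in `w`. -/
theorem Encircles.exists_child [Fintype V] (hw : Function.Injective w) {x : V}
    (h : Encircles G w x) (hd : dg G x < m) :
    ∃ v c, G.Adj x (w v) ∧ G.Adj (w v) (w c) := by
  classical
  by_contra! hno
  have : Finset.univ.image w ⊆ Finset.univ.filter (G.Adj x) := by
    intro u hu
    obtain ⟨i, -, rfl⟩ := Finset.mem_image.1 hu
    rcases h i with h | ⟨s, hs, hs'⟩
    · simpa using h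
    · exact absurd hs' (hno s i hs)
  have h1 := Finset.card_le_card this
  rw [Finset.card_image_of_injective _ hw, Finset.card_fin] at h1
  unfold dg at hd
  have h2 : (Finset.univ.filter (G.Adj x)).card < m := by convert hd
  omega

theorem exists_hasBColoring_of_four_le [Fintype V] (hG : GirthSeven G)
    (hw : Function.Injective w) (hd : ∀ i, m ≤ dg G (w i) + 1)
    (hM : ∀ u, m ≤ dg G u → ∃ i, w i = u) (hm : 4 ≤ m) :
    ∃ l, m ≤ l + 1 ∧ HasBColoring G l := by
  suffices h : ∃ v₀, HasCompletion G w v₀ by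
    obtain ⟨v₀, h⟩ := h
    obtain ⟨l, hl, -, hl'⟩ := h.exists_hasBColoring
    exact ⟨l, hl, hl'⟩
  by_cases hW : ∀ x, IsLink G w x → ¬ Encircles G w x
  · exact ⟨⟨0, by omega⟩, .of_not_encircles hG hw hd hW (fun u hu => Or.inl (hM u hu)) (Or.inl hm)⟩
  · push Not at hW
    obtain ⟨x, hx, hW⟩ := hW
    have hdx : dg G x < m := by
      by_contra! h
      obtain ⟨i, hi⟩ := hM x h
      exact hx.1 i hi
    obtain ⟨v, c, hv, hc⟩ := hW.exists_child hw hdx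
    exact ⟨v, .of_encircles hG hw hd hx hW hv hc hM⟩

theorem exists_hasBColoring_of_not_encircles [Fintype V] (hG : GirthSeven G)
    (hw : Function.Injective w) (hd : ∀ i, m ≤ dg G (w i) + 1)
    (hM : ∀ u, m ≤ dg G u → ∃ i, w i = u) (hm : 3 ≤ m)
    (hW : ∀ x, IsLink G w x → ¬ Encircles G w x) (hne : ∃ u, m ≤ dg G u) :
    ∃ l, m ≤ l ∧ HasBColoring G l := by
  obtain ⟨u₀, hu₀⟩ := hne
  obtain ⟨v₀, rfl⟩ := hM u₀ hu₀
  by_cases hex : 4 ≤ m ∨ (∀ x y, IsLink G w x → IsLink G w y → G.Adj x (w v₀) → G.Adj y (w v₀) →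
      x = y) ∨ ∃ i, i ≠ v₀ ∧ m ≤ dg G (w i)
  · obtain ⟨l, -, hl, hl'⟩ := (HasCompletion.of_not_encircles hG hw hd hW
      (fun u hu => Or.inl (hM u hu)) hex).exists_hasBColoring
    exact ⟨l, hl hu₀, hl'⟩
  · push Not at hex
    obtain ⟨h4, ⟨x, -, hx, -, hxv, -, -⟩, honly⟩ := hex
    obtain rfl : m = 3 := by omega
    obtain ⟨c, hcv, hxc⟩ := hx.exists_ne v₀
    have hvx : w v₀ ≠ x := hx.1 v₀
    have hcx : w c ≠ x := hx.1 c
    have hvc : w v₀ ≠ w c := fun e => hcv (hw e).symm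
    have hdx : 3 ≤ dg G x + 1 := by
      classical
      have : ({w v₀, w c} : Finset V) ⊆ Finset.univ.filter (G.Adj x) := by
        intro u hu
        simp only [Finset.mem_insert, Finset.mem_singleton] at hu
        rcases hu with rfl | rfl <;> simpa
      have h := Finset.card_le_card this
      rw [Finset.card_pair hvc] at h
      have h' : 2 ≤ dg G x := by
        unfold dg
        convert h
      omega
    have hnl : ∀ y, ¬ IsLink G ![w v₀, x, w c] y := by
      rintro y ⟨hy, i, j, hij, hi, hj⟩
      have hyx : x ≠ y := hy 1
      have h1 : G.Adj y (w v₀) → G.Adj y x → False := fun h h' => hG.no3 h' hxv h.symm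
      have h2 : G.Adj y (w c) → G.Adj y x → False := fun h h' => hG.no3 h' hxc h.symm
      have h3 : G.Adj y (w v₀) → G.Adj y (w c) → False := fun h h' =>
        hG.no4 hxv h.symm h' hxc.symm hyx hvc
      fin_cases i <;> fin_cases j <;> simp at hij hi hj <;> tauto
    have hinj : Function.Injective ![w v₀, x, w c] := by
      intro i j hij
      fin_cases i <;> fin_cases j <;> simp at hij ⊢ <;>
        first | exact hvx hij | exact hvx hij.symm | exact hvc hij | exact hvc hij.symm |
          exact hcx hij | exact hcx hij.symm
    obtain ⟨l, -, hl, hl'⟩ := (HasCompletion.of_not_encircles (v₀ := 0) hG hinj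
      (by
        intro i
        fin_cases i
        · exact hd v₀
        · exact hdx
        · exact hd c)
      (fun y hy => absurd hy (hnl y))
      (fun u hu => by
        obtain ⟨i, rfl⟩ := hM u hu
        refine Or.inl ⟨0, ?_⟩
        by_contra hne
        exact absurd (honly i fun e => hne (by rw [e]; rfl)) (by omega))
      (Or.inr (Or.inl fun y _ hy => absurd hy (hnl y)))).exists_hasBColoring
    exact ⟨l, hl hu₀, hl'⟩

end Cases

section Partial

variable {V : Type} {G : SimpleGraph V} {m : ℕ} {w : Fin m → V}

/-- A partial proper coloring in which every color class has a vertex seeing all other colors. -/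
structure IsPartialBColoring {V : Type} (G : SimpleGraph V) {m : ℕ} (f : V → Option (Fin m)) :
    Prop where
  proper : PProper G f
  exists_b : ∀ i, ∃ v, f v = some i ∧ ∀ j, j ≠ i → ∃ u, G.Adj v u ∧ f u = some j

theorem le_dg_add_one [Fintype V] {f : V → Option (Fin m)} {v : V} {i : Fin m}
    (hb : ∀ j, j ≠ i → ∃ u, G.Adj v u ∧ f u = some j) : m ≤ dg G v + 1 ∧
      (dg G v < m → (∀ u, G.Adj v u → f u ≠ none) ∧
        ∀ u u', G.Adj v u → G.Adj v u' → f u = f u' → u = u') := by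
  classical
  have hdg : dg G v = (Finset.univ.filter (G.Adj v)).card := by
    unfold dg
    congr
  have hsub : (Finset.univ.erase i).image some ⊆ (Finset.univ.filter (G.Adj v)).image f := by
    intro a ha
    obtain ⟨j, hj, rfl⟩ := Finset.mem_image.1 ha
    obtain ⟨u, hu, hfu⟩ := hb j (Finset.ne_of_mem_erase hj)
    exact Finset.mem_image.2 ⟨u, by simpa using hu, hfu⟩
  have h1 := Finset.card_le_card hsub
  have h2 : ((Finset.univ.filter (G.Adj v)).image f).card ≤ (Finset.univ.filter (G.Adj v)).card :=
    Finset.card_image_le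
  have h3 : ((Finset.univ.erase i).image some).card + 1 = m := by
    rw [Finset.card_image_of_injective _ (Option.some_injective _),
      Finset.card_erase_add_one (Finset.mem_univ _), Finset.card_fin]
  refine ⟨by omega, fun hlt => ⟨fun u hu hu0 => ?_, fun u u' hu hu' he => ?_⟩⟩
  · have heq := Finset.eq_of_subset_of_card_le hsub (by omega)
    have : f u ∈ (Finset.univ.filter (G.Adj v)).image f :=
      Finset.mem_image.2 ⟨u, by simpa using hu, rfl⟩
    rw [← heq, hu0] at this
    simp at this
  · exact Finset.card_image_iff.1 (by omega : ((Finset.univ.filter (G.Adj v)).image f).card =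
      (Finset.univ.filter (G.Adj v)).card) (by simpa using hu) (by simpa using hu') he

theorem IsPartialBColoring.card_le [Fintype V] {f : V → Option (Fin m)}
    (hf : IsPartialBColoring G f) (D : Finset V) (hD : ∀ u, m ≤ dg G u + 1 → u ∈ D) :
    m ≤ D.card := by
  choose b hb hb' using hf.exists_b
  have hinj : Function.Injective b := fun i j h =>
    Option.some_injective _ ((hb i).symm.trans (h ▸ hb j))
  have := Finset.card_le_card_of_injOn (s := Finset.univ) (t := D) b
    (fun i _ => hD _ (le_dg_add_one (hb' i)).1) hinj.injOn
  simpa using this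

/-- If the dense vertices are exactly those of `w`, and a link encircles them, then some
neighbour of the link with a further neighbour in `w` has large degree. -/
theorem IsPartialBColoring.not_encircles [Fintype V] {f : V → Option (Fin m)}
    (hf : IsPartialBColoring G f)
    (hD : ∀ u, m ≤ dg G u + 1 → ∃ i, w i = u) {x : V} (hx : ∀ i, w i ≠ x)
    (hdx : dg G x < m)
    (hS : ∀ v c, G.Adj x (w v) → G.Adj (w v) (w c) → dg G (w v) < m)
    (hw : Function.Injective w) (hW : Encircles G w x) : False := by
  choose b hb hb' using hf.exists_b
  have hbi : Function.Injective b := fun i j h =>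
    Option.some_injective _ ((hb i).symm.trans (h ▸ hb j))
  choose p hp using fun i => hD (b i) (le_dg_add_one (hb' i)).1
  have hpi : Function.Injective p := fun i j h => hbi (by rw [← hp, ← hp, h])
  have hps := Finite.surjective_of_injective hpi
  have hwb : ∀ j, ∃ i, b i = w j := fun j => by
    obtain ⟨i, rfl⟩ := hps j
    exact ⟨i, (hp i).symm⟩
  have hsmall : ∀ v c, G.Adj x (w v) → G.Adj (w v) (w c) →
      (∀ u, G.Adj (w v) u → f u ≠ none) ∧
        ∀ u u', G.Adj (w v) u → G.Adj (w v) u' → f u = f u' → u = u' := by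
    intro v c hv hc
    obtain ⟨i, hi⟩ := hwb v
    exact (le_dg_add_one (hi ▸ hb' i)).2 (hS v c hv hc)
  obtain ⟨v, c, hv, hc⟩ := hW.exists_child hw hdx
  obtain ⟨a, ha⟩ := Option.ne_none_iff_exists'.1 ((hsmall v c hv hc).1 x hv.symm)
  have hwa : f (w (p a)) = some a := by rw [hp, hb]
  rcases hW (p a) with h | ⟨s, hs, hs'⟩
  · exact hf.proper _ _ _ h ha hwa
  · exact hx _ ((hsmall s _ hs hs').2 x _ hs.symm hs' (ha.trans hwa.symm)).symm

/-- Exchanging a leaf of the tree formed by `w` and an encircling vertex for that vertex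
destroys all links. -/
theorem Encircles.not_isLink_update (hG : GirthSeven G) (hw : Function.Injective w) {x : V}
    (hx : IsLink G w x) (hW : Encircles G w x) {l : Fin m}
    (hl : (G.Adj x (w l) ∧ ∀ i, ¬ G.Adj (w l) (w i)) ∨
      ∃ s, G.Adj x (w s) ∧ G.Adj (w s) (w l)) (y : V) :
    ¬ IsLink G (Function.update w l x) y := by
  rintro ⟨hy, a, b, hab, ha, hb⟩
  have huniq : ∀ y, IsLink G w y → y = x := fun y hy => hW.eq_of_isLink hG hw hx.1 hy
  have hyx : x ≠ y := by simpa using hy l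
  have hyw : ∀ i, i ≠ l → w i ≠ y := fun i hi => by simpa [hi] using hy i
  have key : ∀ i j, i ≠ l → j ≠ l → i ≠ j → G.Adj y (w i) → G.Adj y (w j) → False := by
    intro i j hi hj hij hyi hyj
    have wij : w i ≠ w j := fun e => hij (hw e)
    by_cases hyl : w l = y
    · subst hyl
      rcases hl with ⟨-, h⟩ | ⟨s, hs, hs'⟩
      · exact h i hyi
      · have : ∀ t, G.Adj (w l) (w t) → w t = w s := by
          intro t ht
          by_contra hts
          rcases hW t with h | ⟨r, hr, hr'⟩
          · exact hG.no4 hs hs' ht h.symm hyx (Ne.symm hts)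
          · by_cases hrs : w r = w s
            · rw [hrs] at hr'
              exact hG.no3 hs' ht hr'.symm
            · exact hG.no5 hs hs' ht hr'.symm hr.symm
        exact wij ((this i hyi).trans (this j hyj).symm)
    · refine hyx (huniq y ⟨fun t => ?_, i, j, hij, hyi, hyj⟩).symm
      by_cases ht : t = l
      · rwa [ht]
      · exact hyw t ht
  have key' : ∀ i, i ≠ l → G.Adj y x → G.Adj y (w i) → False := by
    intro i hi hyx' hyi
    rcases hW i with h | ⟨r, hr, hr'⟩
    · exact hG.no3 hyx' h hyi.symm
    · by_cases hry : w r = y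
      · obtain rfl : r = l := by
          by_contra h
          exact hyw r h hry
        subst hry
        rcases hl with ⟨-, h⟩ | ⟨s, hs, hs'⟩
        · exact h i hyi
        · exact hG.no3 hyx' hs hs'
      · exact hG.no4 hr hr' hyi.symm hyx' (hx.1 i).symm hry
  by_cases hal : a = l <;> by_cases hbl : b = l
  · exact hab (hal.trans hbl.symm)
  · subst hal
    simp only [Function.update_self, Function.update_of_ne hbl] at ha hb
    exact key' b hbl ha hb
  · subst hbl
    simp only [Function.update_self, Function.update_of_ne hal] at ha hb
    exact key' a hal hb ha
  · simp only [Function.update_of_ne hal, Function.update_of_ne hbl] at ha hb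
    exact key a b hal hbl hab ha hb

theorem injective_update (hw : Function.Injective w) {l : Fin m} {x : V} (hx : ∀ i, w i ≠ x) :
    Function.Injective (Function.update w l x) := by
  intro i j h
  by_cases hi : i = l <;> by_cases hj : j = l
  · exact hi.trans hj.symm
  · subst hi
    rw [Function.update_self, Function.update_of_ne hj] at h
    exact absurd h.symm (hx j)
  · subst hj
    rw [Function.update_self, Function.update_of_ne hi] at h
    exact absurd h (hx i)
  · rw [Function.update_of_ne hi, Function.update_of_ne hj] at h
    exact hw h

theorem exists_hasBColoring_of_dense_link [Fintype V] (hG : GirthSeven G)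
    (hw : Function.Injective w) (hd : ∀ i, m ≤ dg G (w i) + 1)
    (hM : ∀ u, m ≤ dg G u → ∃ i, w i = u) {x : V} (hx : IsLink G w x)
    (hW : Encircles G w x)
    (hS : ∀ v c, G.Adj x (w v) → G.Adj (w v) (w c) → dg G (w v) < m) (hne : ∃ u, m ≤ dg G u)
    (hdx : m ≤ dg G x + 1) : ∃ l, m ≤ l ∧ HasBColoring G l := by
  have hdx' : dg G x < m := by
    by_contra! h
    obtain ⟨i, hi⟩ := hM x h
    exact hx.1 i hi
  obtain ⟨u₀, hu₀⟩ := hne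
  obtain ⟨v₀, rfl⟩ := hM u₀ hu₀
  obtain ⟨l, hlv, hl⟩ : ∃ l, l ≠ v₀ ∧ ((G.Adj x (w l) ∧ ∀ i, ¬ G.Adj (w l) (w i)) ∨
      ∃ s, G.Adj x (w s) ∧ G.Adj (w s) (w l)) := by
    have : ∃ s, s ≠ v₀ ∧ G.Adj x (w s) ∧ ¬ G.Adj (w s) (w v₀) := by
      obtain ⟨s, hs, hxs⟩ := hx.exists_ne v₀
      by_cases h : G.Adj (w s) (w v₀)
      · obtain ⟨t, ht, hxt⟩ := hx.exists_ne s
        refine ⟨t, ?_, hxt, fun h' => ?_⟩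
        · rintro rfl
          exact hG.no3 hxs h hxt.symm
        · exact hG.no4 hxs h h'.symm hxt.symm (hx.1 v₀).symm fun e => ht (hw e).symm
      · exact ⟨s, hs, hxs, h⟩
    obtain ⟨s, hs, hxs, hsv⟩ := this
    by_cases h : ∃ c, G.Adj (w s) (w c)
    · obtain ⟨c, hc⟩ := h
      refine ⟨c, ?_, Or.inr ⟨s, hxs, hc⟩⟩
      rintro rfl
      exact hsv hc
    · push Not at h
      exact ⟨s, hs, Or.inl ⟨hxs, h⟩⟩
  have hnl := hW.not_isLink_update hG hw hx hl
  have hwv : Function.update w l x v₀ = w v₀ := Function.update_of_ne hlv.symm _ _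
  obtain ⟨k, -, hk, hk'⟩ := (HasCompletion.of_not_encircles (v₀ := v₀) hG
    (injective_update (l := l) hw hx.1)
    (fun i => by
      by_cases h : i = l
      · subst h
        rwa [Function.update_self]
      · rw [Function.update_of_ne h]
        exact hd i)
    (fun y hy => absurd hy (hnl y))
    (fun u hu => by
      obtain ⟨i, rfl⟩ := hM u hu
      by_cases h : i = l
      · subst h
        right
        rcases hl with ⟨h, -⟩ | ⟨s, hs, hs'⟩
        · exact ⟨i, hlv, by rwa [Function.update_self], by rwa [Function.update_self]⟩
        · have hsi : s ≠ i := fun e => hs'.ne (e ▸ rfl)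
          have := hS s i hs hs'
          refine ⟨s, ?_, by rwa [Function.update_of_ne hsi], by rwa [Function.update_of_ne hsi]⟩
          rintro rfl
          omega
      · exact Or.inl ⟨i, Function.update_of_ne h _ _⟩)
    (Or.inr (Or.inl fun y _ hy => absurd hy (hnl y)))).exists_hasBColoring
  exact ⟨k, hk (by rwa [hwv]), hk'⟩

/-- If exchanging a neighbour `w v` of an encircling vertex for `z` produces another encircling
vertex, then `z` is adjacent to the children of `w v`, and the first encircling vertex has
only one neighbour in `w` besides `w v`. -/
theorem Encircles.of_update (hG : GirthSeven G) (hw : Function.Injective w) {x z : V}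
    (hx : IsLink G w x) (hW : Encircles G w x) (hz : ∀ i, w i ≠ z) (hzx : z ≠ x) {v c : Fin m}
    (hv : G.Adj x (w v)) (hc : G.Adj (w v) (w c)) {y : V}
    (hy : IsLink G (Function.update w v z) y) (hY : Encircles G (Function.update w v z) y) :
    G.Adj z (w c) ∧ ∀ s s', s ≠ v → s' ≠ v → G.Adj x (w s) → G.Adj x (w s') → s = s' := by
  have hloose : ∀ p, (∀ i, w i ≠ p) → p ≠ x → ∀ i j, G.Adj p (w i) → G.Adj p (w j) → i = j := by
    intro p hp hpx i j hi hj
    by_contra hij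
    exact hpx (hW.eq_of_isLink hG hw hx.1 ⟨hp, i, j, hij, hi, hj⟩)
  have hne : ∀ {i j}, i ≠ j → w i ≠ w j := fun h e => h (hw e)
  have hcv : c ≠ v := fun e => hc.ne (e ▸ rfl)
  have hyz : z ≠ y := by simpa using hy.1 v
  have hyw : ∀ i, i ≠ v → w i ≠ y := fun i hi => by simpa [hi] using hy.1 i
  have henc : ∀ i, i ≠ v → G.Adj y (w i) ∨ (G.Adj y z ∧ G.Adj z (w i)) ∨
      ∃ s, s ≠ v ∧ G.Adj y (w s) ∧ G.Adj (w s) (w i) := by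
    intro i hi
    have := hY i
    rw [Function.update_of_ne hi] at this
    refine this.imp id ?_
    rintro ⟨s, hs, hs'⟩
    by_cases h : s = v
    · subst h
      rw [Function.update_self] at hs hs'
      exact Or.inl ⟨hs, hs'⟩
    · rw [Function.update_of_ne h] at hs hs'
      exact Or.inr ⟨s, h, hs, hs'⟩
  obtain ⟨s₀, hs₀, hxs₀⟩ := hx.exists_ne v
  have hyx : y ≠ x := by
    rintro rfl
    rcases henc c hcv with h | ⟨h, h'⟩ | ⟨s, hs, h, h'⟩
    · exact hG.no3 hv hc h.symm
    · exact hG.no4 hv hc h'.symm h.symm (hx.1 c).symm (hz v)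
    · exact hG.no4 hv hc h'.symm h.symm (hx.1 c).symm (hne hs.symm)
  have hyv : w v ≠ y := by
    rintro rfl
    rcases henc s₀ hs₀ with h | ⟨h, h'⟩ | ⟨s, hs, h, h'⟩
    · exact hG.no3 hv h hxs₀.symm
    · exact hG.no4 hv h h' hxs₀.symm hzx.symm (hne hs₀.symm)
    · exact hG.no4 hv h h' hxs₀.symm (hx.1 s).symm (hne hs₀.symm)
  have hyw' : ∀ i, w i ≠ y := fun i => by
    by_cases h : i = v
    · rwa [h]
    · exact hyw i h
  have hly := hloose y hyw' hyx
  obtain ⟨t, htv, hyt⟩ : ∃ t, t ≠ v ∧ G.Adj y (w t) := by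
    obtain ⟨t, ht, ht'⟩ := hy.exists_ne v
    exact ⟨t, ht, by rwa [Function.update_of_ne ht] at ht'⟩
  have hstar : ∀ i, i ≠ v → i = t ∨ (G.Adj y z ∧ G.Adj z (w i)) ∨ G.Adj (w t) (w i) := by
    intro i hi
    rcases henc i hi with h | h | ⟨s, -, h, h'⟩
    · exact Or.inl (hly i t h hyt)
    · exact Or.inr (Or.inl h)
    · exact Or.inr (Or.inr (hly s t h hyt ▸ h'))
  have hzc : G.Adj z (w c) := by
    by_contra hzc
    obtain rfl : c = t := by
      rcases hstar c hcv with h | h | h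
      · exact h
      · exact absurd h.2 hzc
      · exfalso
        rcases hW t with h' | ⟨r, hr, hr'⟩
        · exact hG.no4 h' h hc.symm hv.symm (hx.1 c).symm (hne htv)
        · by_cases hrv : r = v
          · subst hrv
            exact hG.no3 hr' h hc.symm
          · exact hG.no5 hr hr' h hc.symm hv.symm
    rcases hstar s₀ hs₀ with h | ⟨h, h'⟩ | h
    · subst h
      exact hG.no3 hv hc hxs₀.symm
    · exact hG.no6 h h' hxs₀.symm hv hc hyt.symm (hyw' s₀).symm hzx (hne hs₀) (hx.1 c).symm
        hyv (hz c)
    · exact hG.no4 hv hc h hxs₀.symm (hx.1 c).symm (hne hs₀.symm)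
  refine ⟨hzc, ?_⟩
  have hs : ∀ s, s ≠ v → G.Adj x (w s) → s = t ∨ G.Adj (w t) (w s) := by
    intro s hsv hxs
    rcases hstar s hsv with h | ⟨-, h⟩ | h
    · exact Or.inl h
    · obtain rfl := hloose z hz hzx s c h hzc
      exact (hG.no3 hv hc hxs.symm).elim
    · exact Or.inr h
  intro s s' hsv hsv' hxs hxs'
  rcases hs s hsv hxs with rfl | h <;> rcases hs s' hsv' hxs' with rfl | h'
  · rfl
  · exact (hG.no3 hxs h' hxs'.symm).elim
  · exact (hG.no3 hxs' h hxs.symm).elim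
  · by_contra hss
    exact hG.no4 hxs h.symm h' hxs'.symm (hx.1 t).symm (hne hss)

theorem exists_hasBColoring_of_update [Fintype V] (hG : GirthSeven G)
    (hw : Function.Injective w) (hd : ∀ i, m ≤ dg G (w i) + 1)
    (hM : ∀ u, m ≤ dg G u → ∃ i, w i = u) (hm : 3 ≤ m) {z : V} (hz : ∀ i, w i ≠ z)
    (hdz : m ≤ dg G z + 1) {v : Fin m} (hv : dg G (w v) < m)
    (hY : ∀ y, IsLink G (Function.update w v z) y → ¬ Encircles G (Function.update w v z) y)
    (hne : ∃ u, m ≤ dg G u) : ∃ l, m ≤ l ∧ HasBColoring G l := by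
  refine exists_hasBColoring_of_not_encircles hG (injective_update (l := v) hw hz) (fun i => ?_)
    (fun u hu => ?_) hm hY hne
  · by_cases h : i = v
    · subst h
      rwa [Function.update_self]
    · rw [Function.update_of_ne h]
      exact hd i
  · obtain ⟨i, rfl⟩ := hM u hu
    refine ⟨i, Function.update_of_ne ?_ _ _⟩
    rintro rfl
    omega

theorem exists_hasBColoring_of_exchange [Fintype V] (hG : GirthSeven G)
    (hw : Function.Injective w) (hd : ∀ i, m ≤ dg G (w i) + 1)
    (hM : ∀ u, m ≤ dg G u → ∃ i, w i = u) (hm : 3 ≤ m) {x : V} (hx : IsLink G w x)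
    (hW : Encircles G w x)
    (hS : ∀ v c, G.Adj x (w v) → G.Adj (w v) (w c) → dg G (w v) < m) (hne : ∃ u, m ≤ dg G u)
    (hdx : dg G x + 1 < m) {z : V} (hz : ∀ i, w i ≠ z) (hdz : m ≤ dg G z + 1) :
    ∃ l, m ≤ l ∧ HasBColoring G l := by
  by_contra hno
  have hzx : z ≠ x := by
    rintro rfl
    omega
  have hbad : ∀ v c, G.Adj x (w v) → G.Adj (w v) (w c) → G.Adj z (w c) ∧
      ∀ s s', s ≠ v → s' ≠ v → G.Adj x (w s) → G.Adj x (w s') → s = s' := by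
    intro v c hv hc
    by_contra hcon
    refine hno (exists_hasBColoring_of_update hG hw hd hM hm hz hdz (hS v c hv hc)
      (fun y hy hY => hcon (hW.of_update hG hw hx hz hzx hv hc hy hY)) hne)
  have huniq : ∀ i j, G.Adj z (w i) → G.Adj z (w j) → i = j := by
    intro i j hi hj
    by_contra hij
    exact hzx (hW.eq_of_isLink hG hw hx.1 ⟨hz, i, j, hij, hi, hj⟩)
  obtain ⟨v, c, hv, hc⟩ := hW.exists_child hw (by omega : dg G x < m)
  obtain ⟨hzc, hs⟩ := hbad v c hv hc
  classical
  obtain ⟨s₀, hs₀, hxs₀⟩ := hx.exists_ne v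
  have h2 : 2 ≤ dg G x := by
    have : ({w v, w s₀} : Finset V) ⊆ Finset.univ.filter (G.Adj x) := by
      intro u hu
      simp only [Finset.mem_insert, Finset.mem_singleton] at hu
      rcases hu with rfl | rfl <;> simpa
    have h := Finset.card_le_card this
    rw [Finset.card_pair fun e => hs₀ (hw e).symm] at h
    unfold dg
    convert h
  obtain ⟨d, hdm⟩ : ∃ d, d ∉ ({v, c, s₀} : Finset (Fin m)) := by
    by_contra! h
    have h3 := Finset.card_le_card (fun d _ => h d : Finset.univ ⊆ ({v, c, s₀} : Finset (Fin m)))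
    have h4 : ({v, c, s₀} : Finset (Fin m)).card ≤ 3 := Finset.card_le_three
    rw [Finset.card_fin] at h3
    omega
  simp only [Finset.mem_insert, Finset.mem_singleton, not_or] at hdm
  obtain ⟨hdv, hdc, hds⟩ := hdm
  rcases hW d with h | ⟨r, hr, hr'⟩
  · exact hds (hs d s₀ hdv hs₀ h hxs₀)
  · exact hdc (huniq d c (hbad r d hr hr').1 hzc)

theorem exists_hasBColoring_of_partial_of_card [Fintype V] (hG : GirthSeven G)
    (hw : Function.Injective w) (hd : ∀ i, m ≤ dg G (w i) + 1)
    (hM : ∀ u, m ≤ dg G u → ∃ i, w i = u) (hm : 3 ≤ m) {f : V → Option (Fin m)}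
    (hf : IsPartialBColoring G f) : ∃ l, m ≤ l ∧ HasBColoring G l := by
  by_cases hne : ∃ u, m ≤ dg G u
  swap
  · push Not at hne
    obtain ⟨c, hc, hcf⟩ := exists_extension_of_dg_lt f hf.proper fun u _ => hne u
    obtain ⟨l, hl, hl'⟩ := exists_hasBColoring_of_bVertices c hc Finset.univ (fun i _ => by
      obtain ⟨v, hv, hb⟩ := hf.exists_b i
      refine ⟨v, hcf v i hv, fun j hj => ?_⟩
      obtain ⟨u, hu, hfu⟩ := hb j (hcf v i hv ▸ hj)
      exact ⟨u, hu, hcf u j hfu⟩)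
    exact ⟨l, by simpa using hl, hl'⟩
  by_cases hW : ∀ x, IsLink G w x → ¬ Encircles G w x
  · exact exists_hasBColoring_of_not_encircles hG hw hd hM hm hW hne
  push Not at hW
  obtain ⟨x, hx, hW⟩ := hW
  by_cases hS : ∀ v c, G.Adj x (w v) → G.Adj (w v) (w c) → dg G (w v) < m
  swap
  · push Not at hS
    obtain ⟨v, c, hv, hc, hdv⟩ := hS
    obtain ⟨l, -, hl, hl'⟩ := (HasCompletion.of_encircles hG hw hd hx hW hv hc hM).exists_hasBColoring
    exact ⟨l, hl hdv, hl'⟩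
  by_cases hdx : m ≤ dg G x + 1
  · exact exists_hasBColoring_of_dense_link hG hw hd hM hx hW hS hne hdx
  by_cases hD : ∀ u, m ≤ dg G u + 1 → ∃ i, w i = u
  · exact (hf.not_encircles hD hx.1 (by omega) hS hw hW).elim
  · push Not at hD
    obtain ⟨z, hdz, hz⟩ := hD
    exact exists_hasBColoring_of_exchange hG hw hd hM hm hx hW hS hne (by omega) hz hdz

theorem IsPartialBColoring.exists_hasBColoring [Fintype V] (hG : GirthSeven G) {k : ℕ}
    (hk : 3 ≤ k) {f : V → Option (Fin k)} (hf : IsPartialBColoring G f) :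
    ∃ l, k ≤ l ∧ HasBColoring G l := by
  classical
  let D : ℕ → Finset V := fun n => Finset.univ.filter fun v => n ≤ dg G v + 1
  have hD : ∀ n v, v ∈ D n ↔ n ≤ dg G v + 1 := fun n v => by simp [D]
  have hkD : k ≤ (D k).card := hf.card_le _ fun u hu => (hD k u).2 hu
  have hkV : k ≤ Fintype.card V := hkD.trans (Finset.card_le_univ _)
  obtain ⟨m, hm⟩ : ∃ m, m = Nat.findGreatest (fun n => n ≤ (D n).card) (Fintype.card V) := ⟨_, rfl⟩
  have hkm : k ≤ m := hm ▸ Nat.le_findGreatest hkV hkD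
  have hmD : m ≤ (D m).card := by
    rw [hm]
    exact Nat.findGreatest_spec (P := fun n => n ≤ (D n).card) hkV hkD
  have hmM : (D (m + 1)).card ≤ m := by
    by_cases h : m + 1 ≤ Fintype.card V
    · have := Nat.findGreatest_is_greatest (P := fun n => n ≤ (D n).card) (k := m + 1)
        (by omega) h
      omega
    · have := Finset.card_le_univ (D (m + 1))
      omega
  obtain ⟨W, hW1, hW2, hWc⟩ := Finset.exists_subsuperset_card_eq
    (fun u hu => (hD m u).2 (by have := (hD (m + 1) u).1 hu; omega) : D (m + 1) ⊆ D m) hmM hmD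
  let w : Fin m → V := fun i => W.equivFinOfCardEq hWc |>.symm i
  have hw : Function.Injective w := fun i j h =>
    (W.equivFinOfCardEq hWc).symm.injective (Subtype.ext h)
  have hd : ∀ i, m ≤ dg G (w i) + 1 := fun i => (hD m _).1 (hW2 (Subtype.prop _))
  have hM : ∀ u, m ≤ dg G u → ∃ i, w i = u := fun u hu =>
    ⟨W.equivFinOfCardEq hWc ⟨u, hW1 ((hD (m + 1) u).2 (by omega))⟩, by simp [w]⟩
  rcases hkm.eq_or_lt with h | h
  · subst h
    exact exists_hasBColoring_of_partial_of_card hG hw hd hM hk hf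
  · obtain ⟨l, hl, hl'⟩ := exists_hasBColoring_of_four_le hG hw hd hM (by omega)
    exact ⟨l, by omega, hl'⟩

end Partial

theorem HasBColoring.exists_isPartialBColoring {V : Type} {G : SimpleGraph V} {s : Finset V}
    {k : ℕ} (h : HasBColoring (G.induce (↑s : Set V)) k) :
    ∃ f : V → Option (Fin k), IsPartialBColoring G f := by
  classical
  obtain ⟨c, -, hc, hb⟩ := h
  have hval : ∀ {u a}, (if h : u ∈ (↑s : Set V) then some (c ⟨u, h⟩) else none) = some a →
      ∃ h : u ∈ (↑s : Set V), c ⟨u, h⟩ = a := by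
    intro u a hu
    split_ifs at hu with h
    exact ⟨h, Option.some.inj hu⟩
  refine ⟨fun u => if h : u ∈ (↑s : Set V) then some (c ⟨u, h⟩) else none,
    fun u v a huv hu hv => ?_, fun i => ?_⟩
  · obtain ⟨hus, hu⟩ := hval hu
    obtain ⟨hvs, hv⟩ := hval hv
    exact hc ⟨u, hus⟩ ⟨v, hvs⟩ huv (hu.trans hv.symm)
  · obtain ⟨v, hv, hb⟩ := hb i
    refine ⟨v, by rw [dif_pos v.2, ← hv], fun j hj => ?_⟩
    obtain ⟨u, hu, hcu⟩ := hb j hj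
    exact ⟨u, hu, by rw [dif_pos u.2, ← hcu]⟩

theorem HasBColoring.le_card {V : Type} [Fintype V] {G : SimpleGraph V} {k : ℕ}
    (h : HasBColoring G k) : k ≤ Fintype.card V := by
  obtain ⟨c, hc, -⟩ := h
  simpa using Fintype.card_le_of_surjective c hc

theorem HasBColoring.induce_univ {V : Type} [Fintype V] {G : SimpleGraph V} {k : ℕ}
    (h : HasBColoring G k) : HasBColoring (G.induce (↑(Finset.univ : Finset V) : Set V)) k := by
  obtain ⟨c, hc, hp, hb⟩ := h
  refine ⟨fun u => c u, fun i => ?_, fun u v huv => hp u v huv, fun i => ?_⟩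
  · obtain ⟨v, hv⟩ := hc i
    exact ⟨⟨v, by simp⟩, hv⟩
  · obtain ⟨v, hv, hb⟩ := hb i
    refine ⟨⟨v, by simp⟩, hv, fun j hj => ?_⟩
    obtain ⟨u, hu, hcu⟩ := hb j hj
    exact ⟨⟨u, by simp⟩, hu, hcu⟩

theorem HasBColoring.le_bChromatic {V : Type} [Fintype V] {G : SimpleGraph V} {k : ℕ}
    (h : HasBColoring G k) : k ≤ bChromatic G :=
  le_csSup ⟨Fintype.card V, fun _ (h : HasBColoring G _) => h.le_card⟩ h

theorem hasBColoring_bChromatic {V : Type} [Fintype V] {G : SimpleGraph V}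
    (h : bChromatic G ≠ 0) : HasBColoring G (bChromatic G) := by
  refine Nat.sSup_mem (s := {k | HasBColoring G k})
    (Set.nonempty_iff_ne_empty.2 fun he => h ?_)
    ⟨Fintype.card V, fun _ (h : HasBColoring G _) => h.le_card⟩
  rw [bChromatic, he, csSup_empty, bot_eq_zero]

theorem bChromatic_induce_le_card {V : Type} [Fintype V] (G : SimpleGraph V) (s : Finset V) :
    bChromatic (G.induce (↑s : Set V)) ≤ Fintype.card V := by
  by_cases h : bChromatic (G.induce (↑s : Set V)) = 0
  · omega
  · exact (hasBColoring_bChromatic h).le_card.trans (Fintype.card_subtype_le _)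

theorem bChromatic_induce_le_bRelaxed {V : Type} [Fintype V] (G : SimpleGraph V) (s : Finset V) :
    bChromatic (G.induce (↑s : Set V)) ≤ bRelaxed G :=
  le_csSup ⟨Fintype.card V, by
    rintro _ ⟨t, rfl⟩
    exact bChromatic_induce_le_card G t⟩ ⟨s, rfl⟩

theorem exists_bChromatic_induce_eq {V : Type} [Fintype V] (G : SimpleGraph V) :
    ∃ s : Finset V, bChromatic (G.induce (↑s : Set V)) = bRelaxed G :=
  Nat.sSup_mem (s := {k | ∃ s : Finset V, bChromatic (G.induce (↑s : Set V)) = k})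
    ⟨_, ∅, rfl⟩ ⟨Fintype.card V, by
    rintro _ ⟨t, rfl⟩
    exact bChromatic_induce_le_card G t⟩

/-- if G has girth at least 7 (no cycle of length at most 6) and
φ_r(G) ≥ 3, then φ(G) = φ_r(G). -/
theorem bChromatic_eq_bRelaxed_of_girth {V : Type} [Fintype V] (G : SimpleGraph V)
    (hg : ∀ (v : V) (w : G.Walk v v), w.IsCycle → 7 ≤ w.length)
    (hr : 3 ≤ bRelaxed G) : bChromatic G = bRelaxed G := by
  apply le_antisymm
  · by_cases h : bChromatic G = 0
    · omega
    · exact (hasBColoring_bChromatic h).induce_univ.le_bChromatic.trans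
        (bChromatic_induce_le_bRelaxed G _)
  · obtain ⟨s, hs⟩ := exists_bChromatic_induce_eq G
    have h : HasBColoring (G.induce (↑s : Set V)) (bRelaxed G) :=
      hs ▸ hasBColoring_bChromatic (by omega)
    obtain ⟨f, hf⟩ := h.exists_isPartialBColoring
    obtain ⟨l, hl, hl'⟩ := hf.exists_hasBColoring (girthSeven_of_cycles hg) hr
    exact hl.trans hl'.le_bChromatic
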